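/- Let U be a finite set and p_{U|XYZ} a conditional pmf such that the joint pmf p_XYZ·p_{U|XYZ} satisfies the three Markov chains U−X−Y, Z−(U,Y)−X, and U−(Y,Z)−X. Then every rate R > I(Z;U|Y) is securely achievable for (p_XY, p_{Z|XY}). -/

import Mathlib

open scoped BigOperators
open scoped Classical

namespace SC

/-- `p` is a probability mass function on a finite type. -/
def IsPMF {α : Type*} [Fintype α] (p : α → ℝ) : Prop :=
  (∀ a, 0 ≤ p a) ∧ ∑ a, p a = 1

/-- Total variation distance between pmfs on a finite type. -/
noncomputable def tv {α : Type*} [Fintype α] (p q : α → ℝ) : ℝ :=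
  (1 / 2) * ∑ a, |p a - q a|

/-- Shannon entropy (in bits) of the pushforward of the pmf `p` along `f`. -/
noncomputable def Hof {Ω β : Type*} [Fintype Ω] (p : Ω → ℝ) (f : Ω → β) : ℝ :=
  (∑ b ∈ Finset.univ.image f,
      Real.negMulLog (∑ a ∈ Finset.univ.filter (fun a => f a = b), p a)) / Real.log 2

/-- Conditional Shannon entropy `H(A | B)` (bits) computed from the joint pmf `p`. -/
noncomputable def condEnt {Ω α β : Type*} [Fintype Ω] (p : Ω → ℝ)
    (A : Ω → α) (B : Ω → β) : ℝ :=
  Hof p (fun ω => (A ω, B ω)) - Hof p B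

/-- Conditional mutual information `I(A ; C ∣ B)` (bits) from the joint pmf `p`. -/
noncomputable def cmi {Ω α β γ : Type*} [Fintype Ω] (p : Ω → ℝ)
    (A : Ω → α) (B : Ω → β) (C : Ω → γ) : ℝ :=
  Hof p (fun ω => (A ω, B ω)) + Hof p (fun ω => (B ω, C ω)) - Hof p B
    - Hof p (fun ω => (A ω, B ω, C ω))

/-- The joint pmf `p_XYZ(x,y,z) = p_XY(x,y) · p_{Z|XY}(z|x,y)`. -/
noncomputable def jointXYZ {𝒳 𝒴 𝒵 : Type*} [Fintype 𝒳] [Fintype 𝒴] [Fintype 𝒵]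
    (pXY : 𝒳 × 𝒴 → ℝ) (Q : 𝒳 → 𝒴 → 𝒵 → ℝ) : 𝒳 × 𝒴 × 𝒵 → ℝ :=
  fun w => pXY (w.1, w.2.1) * Q w.1 w.2.1 w.2.2

/-- The `n`-fold product of `p_XYZ`. -/
noncomputable def prodXYZ {𝒳 𝒴 𝒵 : Type*} [Fintype 𝒳] [Fintype 𝒴] [Fintype 𝒵]
    (pXY : 𝒳 × 𝒴 → ℝ) (Q : 𝒳 → 𝒴 → 𝒵 → ℝ) (n : ℕ) :
    (Fin n → 𝒳) × (Fin n → 𝒴) × (Fin n → 𝒵) → ℝ :=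
  fun w => ∏ i, jointXYZ pXY Q (w.1 i, w.2.1 i, w.2.2 i)

/-- The joint pmf of `(U, X, Y, Z)` obtained from `p_XYZ` and a conditional pmf
`p_{U|XYZ}` (with `U` ranging over `Fin k`). -/
noncomputable def jointU {𝒳 𝒴 𝒵 : Type*} [Fintype 𝒳] [Fintype 𝒴] [Fintype 𝒵]
    (pXY : 𝒳 × 𝒴 → ℝ) (Q : 𝒳 → 𝒴 → 𝒵 → ℝ) {k : ℕ}
    (pU : 𝒳 × 𝒴 × 𝒵 → Fin k → ℝ) : Fin k × 𝒳 × 𝒴 × 𝒵 → ℝ :=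
  fun w => jointXYZ pXY Q w.2 * pU w.2 w.1

/-- Message set cardinality `⌈2^{nR}⌉`. -/
noncomputable def msgCard (n : ℕ) (R : ℝ) : ℕ := ⌈(2 : ℝ) ^ ((n : ℝ) * R)⌉₊

/-- Joint pmf on `(Xⁿ, Yⁿ, M, Ẑⁿ)` induced by an `(n, 2^{nR})`-code `(enc, dec)`. -/
noncomputable def inducedPMF {𝒳 𝒴 𝒵 : Type*} [Fintype 𝒳] [Fintype 𝒴] [Fintype 𝒵]
    (pXY : 𝒳 × 𝒴 → ℝ) (n : ℕ) (R : ℝ)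
    (enc : (Fin n → 𝒳) → Fin (msgCard n R) → ℝ)
    (dec : Fin (msgCard n R) → (Fin n → 𝒴) → (Fin n → 𝒵) → ℝ) :
    (Fin n → 𝒳) × (Fin n → 𝒴) × Fin (msgCard n R) × (Fin n → 𝒵) → ℝ :=
  fun w => (∏ i, pXY (w.1 i, w.2.1 i)) * enc w.1 w.2.2.1 * dec w.2.2.1 w.2.1 w.2.2.2

/-- A rate `R ≥ 0` is securely achievable for `(p_XY, p_{Z|XY})`: there is a sequence of
`(n, 2^{nR})`-codes such that for every `ε > 0` there is an `n` with
`‖p_{XⁿYⁿẐⁿ} − p_{XⁿYⁿZⁿ}‖₁ ≤ ε` and `I(M; Xⁿ | Yⁿ, Ẑⁿ) ≤ nε`. -/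
def SecurelyAchievable {𝒳 𝒴 𝒵 : Type*} [Fintype 𝒳] [Fintype 𝒴] [Fintype 𝒵]
    (pXY : 𝒳 × 𝒴 → ℝ) (Q : 𝒳 → 𝒴 → 𝒵 → ℝ) (R : ℝ) : Prop :=
  0 ≤ R ∧
  ∃ enc : (n : ℕ) → (Fin n → 𝒳) → Fin (msgCard n R) → ℝ,
  ∃ dec : (n : ℕ) → Fin (msgCard n R) → (Fin n → 𝒴) → (Fin n → 𝒵) → ℝ,
    (∀ n xs, IsPMF (enc n xs)) ∧ (∀ n m ys, IsPMF (dec n m ys)) ∧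
    ∀ ε : ℝ, 0 < ε → ∃ n : ℕ, 0 < n ∧
      tv (fun w : (Fin n → 𝒳) × (Fin n → 𝒴) × (Fin n → 𝒵) =>
            ∑ m, inducedPMF pXY n R (enc n) (dec n) (w.1, w.2.1, m, w.2.2))
         (prodXYZ pXY Q n) ≤ ε ∧
      cmi (inducedPMF pXY n R (enc n) (dec n))
        (fun w => w.2.2.1) (fun w => (w.2.1, w.2.2.2)) (fun w => w.1) ≤ n * ε

/-- `p_{U|XYZ}` is a conditional pmf whose joint pmf `p_XYZ · p_{U|XYZ}` satisfies the
three Markov chains `U−X−Y`, `Z−(U,Y)−X` and `U−(Y,Z)−X`. -/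
def SecureAux {𝒳 𝒴 𝒵 : Type*} [Fintype 𝒳] [Fintype 𝒴] [Fintype 𝒵]
    (pXY : 𝒳 × 𝒴 → ℝ) (Q : 𝒳 → 𝒴 → 𝒵 → ℝ) {k : ℕ}
    (pU : 𝒳 × 𝒴 × 𝒵 → Fin k → ℝ) : Prop :=
  (∀ w, IsPMF (pU w)) ∧
  cmi (jointU pXY Q pU) (fun w => w.1) (fun w => w.2.1) (fun w => w.2.2.1) = 0 ∧
  cmi (jointU pXY Q pU) (fun w => w.2.2.2) (fun w => (w.1, w.2.2.1)) (fun w => w.2.1) = 0 ∧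
  cmi (jointU pXY Q pU) (fun w => w.1) (fun w => (w.2.2.1, w.2.2.2)) (fun w => w.2.1) = 0

/-- `(p_XY, p_{Z|XY})` is computable with perfect security. -/
def PerfectlySecure {𝒳 𝒴 𝒵 : Type*} [Fintype 𝒳] [Fintype 𝒴] [Fintype 𝒵]
    (pXY : 𝒳 × 𝒴 → ℝ) (Q : 𝒳 → 𝒴 → 𝒵 → ℝ) : Prop :=
  ∃ (k : ℕ) (pU : 𝒳 × 𝒴 × 𝒵 → Fin k → ℝ), SecureAux pXY Q pU

section Marginals

variable {Ω α β γ : Type*} [Fintype Ω]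

/-- The pushforward of the weight function `p` along `f`. -/
noncomputable def marg (p : Ω → ℝ) (f : Ω → β) (b : β) : ℝ :=
  ∑ a ∈ Finset.univ.filter (fun a => f a = b), p a

lemma marg_eq_sum_ite (p : Ω → ℝ) (f : Ω → β) (b : β) :
    marg p f b = ∑ a, if f a = b then p a else 0 := by
  rw [marg, Finset.sum_filter]

lemma marg_nonneg {p : Ω → ℝ} (hp : ∀ a, 0 ≤ p a) (f : Ω → β) (b : β) : 0 ≤ marg p f b :=
  Finset.sum_nonneg fun a _ => hp a

lemma sum_marg_mul [Fintype β] (p : Ω → ℝ) (f : Ω → β) (g : β → ℝ) :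
    ∑ b, marg p f b * g b = ∑ a, p a * g (f a) := by
  simp_rw [marg_eq_sum_ite, Finset.sum_mul]
  rw [Finset.sum_comm]
  refine Finset.sum_congr rfl fun a _ => ?_
  simp [ite_mul]

lemma sum_marg [Fintype β] (p : Ω → ℝ) (f : Ω → β) : ∑ b, marg p f b = ∑ a, p a := by
  simpa using sum_marg_mul p f (fun _ => 1)

lemma isPMF_marg [Fintype β] {p : Ω → ℝ} (hp : IsPMF p) (f : Ω → β) : IsPMF (marg p f) :=
  ⟨marg_nonneg hp.1 f, (sum_marg p f).trans hp.2⟩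

lemma le_marg {p : Ω → ℝ} (hp : ∀ a, 0 ≤ p a) (f : Ω → β) (a : Ω) : p a ≤ marg p f (f a) :=
  Finset.single_le_sum (f := p) (fun b _ => hp b) (by simp)

lemma marg_le_one {p : Ω → ℝ} (hp : IsPMF p) (f : Ω → β) (b : β) : marg p f b ≤ 1 :=
  hp.2 ▸ Finset.sum_le_sum_of_subset_of_nonneg (Finset.subset_univ _) fun a _ _ => hp.1 a

/-- Marginalizing out the second coordinate. -/
lemma sum_marg_pair_right [Fintype β] (p : Ω → ℝ) (f : Ω → α) (g : Ω → β) (a : α) :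
    ∑ b, marg p (fun ω => (f ω, g ω)) (a, b) = marg p f a := by
  simp_rw [marg_eq_sum_ite]
  rw [Finset.sum_comm]
  refine Finset.sum_congr rfl fun ω _ => ?_
  by_cases h : f ω = a <;> simp [h]

/-- Marginalizing out the first coordinate. -/
lemma sum_marg_pair_left [Fintype α] (p : Ω → ℝ) (f : Ω → α) (g : Ω → β) (b : β) :
    ∑ a, marg p (fun ω => (f ω, g ω)) (a, b) = marg p g b := by
  simp_rw [marg_eq_sum_ite]
  rw [Finset.sum_comm]
  refine Finset.sum_congr rfl fun ω _ => ?_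
  by_cases h : g ω = b <;> simp [h]

lemma marg_injective_comp (p : Ω → ℝ) (f : Ω → α) {e : α → β} (he : Function.Injective e)
    (a : α) : marg p (fun ω => e (f ω)) (e a) = marg p f a := by
  simp only [marg_eq_sum_ite, he.eq_iff]

lemma marg_id (p : Ω → ℝ) (a : Ω) : marg p (fun ω => ω) a = p a := by
  simp [marg_eq_sum_ite]

lemma marg_le_marg_comp {p : Ω → ℝ} (hp : ∀ a, 0 ≤ p a) (f : Ω → α) (g : α → β) (a : α) :
    marg p f a ≤ marg p (fun ω => g (f ω)) (g a) :=
  Finset.sum_le_sum_of_subset_of_nonneg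
    (Finset.monotone_filter_right _ fun _ _ h => congrArg g h) fun ω _ _ => hp ω

lemma hof_eq_sum_image (p : Ω → ℝ) (f : Ω → β) :
    Hof p f = (∑ b ∈ Finset.univ.image f, Real.negMulLog (marg p f b)) / Real.log 2 := rfl

lemma hof_mul_log_two (p : Ω → ℝ) (f : Ω → β) :
    Hof p f * Real.log 2 = -∑ ω, p ω * Real.log (marg p f (f ω)) := by
  have h2 : Real.log 2 ≠ 0 := (Real.log_pos one_lt_two).ne'
  rw [hof_eq_sum_image, div_mul_cancel₀ _ h2, ← Finset.sum_neg_distrib,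
    ← Finset.sum_fiberwise_of_maps_to (s := Finset.univ) (t := Finset.univ.image f) (g := f)
      (fun x _ => Finset.mem_image_of_mem _ (Finset.mem_univ x))]
  refine Finset.sum_congr rfl fun b _ => ?_
  rw [Real.negMulLog]
  nth_rewrite 1 [marg]
  rw [neg_mul, Finset.sum_mul, ← Finset.sum_neg_distrib]
  refine Finset.sum_congr rfl fun ω hω => ?_
  rw [(Finset.mem_filter.mp hω).2]

lemma hof_injective_comp (p : Ω → ℝ) (f : Ω → α) {e : α → β} (he : Function.Injective e) :
    Hof p (fun ω => e (f ω)) = Hof p f := by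
  have h2 : Real.log 2 ≠ 0 := (Real.log_pos one_lt_two).ne'
  refine mul_right_cancel₀ h2 ?_
  rw [hof_mul_log_two, hof_mul_log_two]
  simp only [marg_injective_comp p f he]

/-- Conditional entropy as an expected log-likelihood of the conditional pmf `K`. -/
lemma hof_sub_hof_mul_log_two {p : Ω → ℝ} (hp : ∀ ω, 0 ≤ p ω) (A : Ω → α) (B : Ω → β)
    {K : β → α → ℝ}
    (hK : ∀ a b, marg p (fun ω => (A ω, B ω)) (a, b) = marg p B b * K b a) :
    (Hof p (fun ω => (A ω, B ω)) - Hof p B) * Real.log 2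
      = ∑ ω, p ω * -Real.log (K (B ω) (A ω)) := by
  rw [sub_mul, hof_mul_log_two, hof_mul_log_two, neg_sub_neg, ← Finset.sum_sub_distrib]
  refine Finset.sum_congr rfl fun ω _ => ?_
  rcases (hp ω).eq_or_lt with h | h
  · simp [← h]
  have hAB : 0 < marg p (fun ω => (A ω, B ω)) (A ω, B ω) :=
    h.trans_le (le_marg hp (fun ω => (A ω, B ω)) ω)
  have hB : 0 < marg p B (B ω) := h.trans_le (le_marg hp B ω)
  rw [hK] at hAB ⊢
  have hKpos : 0 < K (B ω) (A ω) := (pos_iff_pos_of_mul_pos hAB).mp hB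
  rw [Real.log_mul hB.ne' hKpos.ne']
  ring

lemma cmi_mul_log_two (p : Ω → ℝ) (hp : ∀ ω, 0 ≤ p ω) [Fintype α] [Fintype β] [Fintype γ]
    (A : Ω → α) (B : Ω → β) (C : Ω → γ) :
    cmi p A B C * Real.log 2 = ∑ t : α × β × γ,
      marg p (fun ω => (A ω, B ω)) (t.1, t.2.1) * marg p (fun ω => (B ω, C ω)) t.2
          / marg p B t.2.1 *
        InformationTheory.klFun (marg p (fun ω => (A ω, B ω, C ω)) t /
          (marg p (fun ω => (A ω, B ω)) (t.1, t.2.1) * marg p (fun ω => (B ω, C ω)) t.2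
            / marg p B t.2.1)) := by
  set P := marg p (fun ω => (A ω, B ω, C ω)) with hP
  set PAB := marg p (fun ω => (A ω, B ω)) with hPAB
  set PBC := marg p (fun ω => (B ω, C ω)) with hPBC
  set PB := marg p B with hPB
  have hpt : ∀ t : α × β × γ,
      PAB (t.1, t.2.1) * PBC t.2 / PB t.2.1 *
        InformationTheory.klFun (P t / (PAB (t.1, t.2.1) * PBC t.2 / PB t.2.1))
      = P t * (Real.log (P t) + Real.log (PB t.2.1) - Real.log (PAB (t.1, t.2.1))
          - Real.log (PBC t.2)) + PAB (t.1, t.2.1) * PBC t.2 / PB t.2.1 - P t := by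
    rintro ⟨a, b, c⟩
    have h1 : P (a, b, c) ≤ PAB (a, b) :=
      marg_le_marg_comp hp _ (fun t : α × β × γ => (t.1, t.2.1)) (a, b, c)
    have h2 : P (a, b, c) ≤ PBC (b, c) := marg_le_marg_comp hp _ Prod.snd (a, b, c)
    have h3 : PAB (a, b) ≤ PB b := marg_le_marg_comp hp _ Prod.snd (a, b)
    have h0 : 0 ≤ P (a, b, c) := marg_nonneg hp _ _
    have h0' : 0 ≤ PAB (a, b) := marg_nonneg hp _ _
    have h0'' : 0 ≤ PBC (b, c) := marg_nonneg hp _ _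
    simp only
    rcases h0'.eq_or_lt with hz | hAB
    · have : P (a, b, c) = 0 := by linarith
      simp [← hz, this]
    rcases h0''.eq_or_lt with hz | hBC
    · have : P (a, b, c) = 0 := by linarith
      simp [← hz, this]
    have hBpos : 0 < PB b := hAB.trans_le h3
    rcases h0.eq_or_lt with hz | hpos
    · simp [← hz, InformationTheory.klFun]
    rw [InformationTheory.klFun, Real.log_div hpos.ne' (by positivity),
      Real.log_div (by positivity) hBpos.ne', Real.log_mul hAB.ne' hBC.ne']
    field_simp
    ring
  have hq : ∑ t : α × β × γ, PAB (t.1, t.2.1) * PBC t.2 / PB t.2.1 = ∑ ω, p ω := by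
    rw [← sum_marg p (fun ω => (B ω, C ω)), Fintype.sum_prod_type, Finset.sum_comm]
    refine Finset.sum_congr rfl fun t _ => ?_
    simp only
    rw [← Finset.sum_div, ← Finset.sum_mul, hPAB, sum_marg_pair_left p A B t.1]
    by_cases h : marg p B t.1 = 0
    · have : PBC t ≤ 0 := h ▸ marg_le_marg_comp hp _ Prod.fst t
      have h0 : PBC t = 0 := le_antisymm this (marg_nonneg hp _ _)
      rw [h0]; simpa using h0.symm
    · rw [hPB, mul_div_assoc, mul_div_cancel₀ _ h]
  simp only [hpt, Finset.sum_sub_distrib, Finset.sum_add_distrib]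
  rw [hq, hP, sum_marg, add_sub_cancel_right,
    sum_marg_mul p (fun ω => (A ω, B ω, C ω)) (fun t => Real.log (P t) + Real.log (PB t.2.1)
      - Real.log (PAB (t.1, t.2.1)) - Real.log (PBC t.2)), cmi, sub_mul, sub_mul, add_mul,
    hof_mul_log_two, hof_mul_log_two, hof_mul_log_two, hof_mul_log_two]
  simp only [mul_sub, mul_add, Finset.sum_sub_distrib, Finset.sum_add_distrib, ← hP, ← hPAB,
    ← hPBC, ← hPB]
  ring

lemma cmi_nonneg (p : Ω → ℝ) (hp : ∀ ω, 0 ≤ p ω) [Fintype α] [Fintype β] [Fintype γ]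
    (A : Ω → α) (B : Ω → β) (C : Ω → γ) : 0 ≤ cmi p A B C := by
  have h := cmi_mul_log_two p hp A B C
  refine nonneg_of_mul_nonneg_left (b := Real.log 2) ?_ (Real.log_pos one_lt_two)
  rw [h]
  refine Finset.sum_nonneg fun t _ => ?_
  have hq : 0 ≤ marg p (fun ω => (A ω, B ω)) (t.1, t.2.1) * marg p (fun ω => (B ω, C ω)) t.2
      / marg p B t.2.1 :=
    div_nonneg (mul_nonneg (marg_nonneg hp _ _) (marg_nonneg hp _ _)) (marg_nonneg hp _ _)
  exact mul_nonneg hq (InformationTheory.klFun_nonneg (div_nonneg (marg_nonneg hp _ _) hq))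

lemma marg_mul_marg_of_cmi_eq_zero {p : Ω → ℝ} (hp : ∀ ω, 0 ≤ p ω)
    [Fintype α] [Fintype β] [Fintype γ] {A : Ω → α} {B : Ω → β} {C : Ω → γ}
    (h : cmi p A B C = 0) (a : α) (b : β) (c : γ) :
    marg p (fun ω => (A ω, B ω, C ω)) (a, b, c) * marg p B b
      = marg p (fun ω => (A ω, B ω)) (a, b) * marg p (fun ω => (B ω, C ω)) (b, c) := by
  have hsum := cmi_mul_log_two p hp A B C
  rw [h, zero_mul, eq_comm, Finset.sum_eq_zero_iff_of_nonneg] at hsum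
  swap
  · intro t _
    have hq : 0 ≤ marg p (fun ω => (A ω, B ω)) (t.1, t.2.1) * marg p (fun ω => (B ω, C ω)) t.2
        / marg p B t.2.1 :=
      div_nonneg (mul_nonneg (marg_nonneg hp _ _) (marg_nonneg hp _ _)) (marg_nonneg hp _ _)
    exact mul_nonneg hq (InformationTheory.klFun_nonneg (div_nonneg (marg_nonneg hp _ _) hq))
  have ht := hsum (a, b, c) (Finset.mem_univ _)
  simp only at ht
  have hPle : marg p (fun ω => (A ω, B ω, C ω)) (a, b, c)
      ≤ marg p (fun ω => (B ω, C ω)) (b, c) := marg_le_marg_comp hp _ Prod.snd (a, b, c)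
  have hPle' : marg p (fun ω => (A ω, B ω, C ω)) (a, b, c)
      ≤ marg p (fun ω => (A ω, B ω)) (a, b) :=
    marg_le_marg_comp hp _ (fun t : α × β × γ => (t.1, t.2.1)) (a, b, c)
  have hBle : marg p (fun ω => (A ω, B ω)) (a, b) ≤ marg p B b :=
    marg_le_marg_comp hp _ Prod.snd (a, b)
  have h0 := marg_nonneg hp (fun ω => (A ω, B ω, C ω)) (a, b, c)
  rcases (marg_nonneg hp (fun ω => (A ω, B ω)) (a, b)).eq_or_lt with hz | hAB
  · rw [← hz, zero_mul, le_antisymm (hPle'.trans hz.ge) h0, zero_mul]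
  have hBpos := hAB.trans_le hBle
  rcases (marg_nonneg hp (fun ω => (B ω, C ω)) (b, c)).eq_or_lt with hz | hBC
  · rw [← hz, mul_zero, le_antisymm (hPle.trans hz.ge) h0, zero_mul]
  have hqpos : 0 < marg p (fun ω => (A ω, B ω)) (a, b) * marg p (fun ω => (B ω, C ω)) (b, c)
      / marg p B b := by positivity
  have hk := (mul_eq_zero.mp ht).resolve_left hqpos.ne'
  rw [InformationTheory.klFun_eq_zero_iff (div_nonneg h0 hqpos.le), div_eq_one_iff_eq hqpos.ne',
    eq_div_iff hBpos.ne'] at hk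
  exact hk

/-- Disintegration of a finite nonnegative weight function. -/
lemma exists_kernel [Fintype α] [Nonempty α] {F : β → α → ℝ} (hF : ∀ b a, 0 ≤ F b a) :
    ∃ K : β → α → ℝ, (∀ b, IsPMF (K b)) ∧ ∀ b a, F b a = (∑ a', F b a') * K b a := by
  have hmain : ∀ b, ∃ K : α → ℝ, IsPMF K ∧ ∀ a, F b a = (∑ a', F b a') * K a := by
    intro b
    by_cases h : ∑ a', F b a' = 0
    · refine ⟨fun a => if a = Classical.arbitrary α then 1 else 0,
        ⟨fun a => by dsimp only; split_ifs <;> norm_num, by simp⟩, fun a => ?_⟩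
      rw [h, zero_mul]
      exact (Finset.sum_eq_zero_iff_of_nonneg fun a _ => hF b a).mp h a (Finset.mem_univ a)
    · refine ⟨fun a => F b a / ∑ a', F b a', ⟨fun a => div_nonneg (hF b a)
        (Finset.sum_nonneg fun a _ => hF b a), ?_⟩, fun a => ?_⟩
      · rw [← Finset.sum_div, div_self h]
      · rw [mul_div_cancel₀ _ h]
  choose K hK using hmain
  exact ⟨K, fun b => (hK b).1, fun b => (hK b).2⟩

lemma exists_kernel_marg [Fintype α] [Nonempty α] {p : Ω → ℝ} (hp : ∀ ω, 0 ≤ p ω)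
    (A : Ω → α) (B : Ω → β) :
    ∃ K : β → α → ℝ, (∀ b, IsPMF (K b)) ∧
      ∀ a b, marg p (fun ω => (A ω, B ω)) (a, b) = marg p B b * K b a := by
  obtain ⟨K, hK, h⟩ := exists_kernel (F := fun b a => marg p (fun ω => (A ω, B ω)) (a, b))
    fun b a => marg_nonneg hp _ _
  refine ⟨K, hK, fun a b => ?_⟩
  rw [← sum_marg_pair_left p A B b]
  exact h b a

/-- A Markov chain `A - B - C` is witnessed by a kernel from `B` to `A`. -/
lemma exists_kernel_of_cmi_eq_zero [Fintype α] [Fintype β] [Fintype γ] [Nonempty α]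
    {p : Ω → ℝ} (hp : ∀ ω, 0 ≤ p ω) {A : Ω → α} {B : Ω → β} {C : Ω → γ}
    (h : cmi p A B C = 0) :
    ∃ K : β → α → ℝ, (∀ b, IsPMF (K b)) ∧
      (∀ a b, marg p (fun ω => (A ω, B ω)) (a, b) = marg p B b * K b a) ∧
      ∀ a b c, marg p (fun ω => (A ω, B ω, C ω)) (a, b, c)
        = marg p (fun ω => (B ω, C ω)) (b, c) * K b a := by
  obtain ⟨K, hK, hAB⟩ := exists_kernel_marg hp A B
  refine ⟨K, hK, hAB, fun a b c => ?_⟩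
  have hf := marg_mul_marg_of_cmi_eq_zero hp h a b c
  rw [hAB] at hf
  by_cases hb : marg p B b = 0
  · have hBC : marg p (fun ω => (B ω, C ω)) (b, c) = 0 := by
      rw [← sum_marg_pair_right p B C b] at hb
      exact (Finset.sum_eq_zero_iff_of_nonneg fun c _ => marg_nonneg hp _ _).mp hb c
        (Finset.mem_univ c)
    have hABC := hBC
    rw [← sum_marg_pair_left p A (fun ω => (B ω, C ω)) (b, c)] at hABC
    rw [hBC, zero_mul]
    exact (Finset.sum_eq_zero_iff_of_nonneg fun a _ => marg_nonneg hp _ _).mp hABC a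
      (Finset.mem_univ a)
  · refine mul_right_cancel₀ hb ?_
    rw [hf]; ring

/-- A pmf of the form `p(b, c) K(a | b)` has vanishing conditional mutual information. -/
lemma cmi_eq_zero_of_kernel [Fintype α] [Fintype β] [Fintype γ]
    {p : Ω → ℝ} (hp : ∀ ω, 0 ≤ p ω) {A : Ω → α} {B : Ω → β} {C : Ω → γ} {K : β → α → ℝ}
    (h : ∀ a b c, marg p (fun ω => (A ω, B ω, C ω)) (a, b, c)
        = marg p (fun ω => (B ω, C ω)) (b, c) * K b a) :
    cmi p A B C = 0 := by
  have h2 : Real.log 2 ≠ 0 := (Real.log_pos one_lt_two).ne'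
  refine (mul_eq_zero.mp ?_).resolve_right h2
  have hAB : ∀ a b, marg p (fun ω => (A ω, B ω)) (a, b) = marg p B b * K b a := by
    intro a b
    rw [← sum_marg_pair_right p (fun ω => (A ω, B ω)) C (a, b), ← sum_marg_pair_right p B C b,
      Finset.sum_mul]
    refine Finset.sum_congr rfl fun c _ => ?_
    rw [← h]
    exact marg_injective_comp p (fun ω => (A ω, B ω, C ω))
      (Equiv.prodAssoc α β γ).symm.injective (a, b, c)
  have h1 := hof_sub_hof_mul_log_two hp A B hAB
  have h3 := hof_sub_hof_mul_log_two hp A (fun ω => (B ω, C ω)) (K := fun t => K t.1)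
    (fun a t => h a t.1 t.2)
  simp only at h3
  rw [cmi]
  linarith

end Marginals

section Continuity

lemma abs_negMulLog_sub_le {s t : ℝ} (hs : 0 ≤ s) (hs1 : s ≤ 1) (ht : 0 ≤ t) (ht1 : t ≤ 1) :
    |Real.negMulLog s - Real.negMulLog t| ≤ Real.negMulLog |s - t| + |s - t| := by
  wlog hst : s ≤ t generalizing s t
  · rw [abs_sub_comm, abs_sub_comm s t]
    exact this ht ht1 hs hs1 (le_of_not_ge hst)
  rw [abs_sub_comm s t, abs_of_nonneg (sub_nonneg.mpr hst)]
  have hd : 0 ≤ t - s := sub_nonneg.mpr hst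
  rcases hs.eq_or_lt with rfl | hs0
  · have := Real.negMulLog_nonneg ht ht1
    simp only [Real.negMulLog_zero, zero_sub, abs_neg, sub_zero, abs_of_nonneg this]
    linarith
  have ht0 : 0 < t := hs0.trans_le hst
  have hη : 0 ≤ Real.negMulLog (t - s) := Real.negMulLog_nonneg hd (by linarith)
  rw [abs_le]
  simp only [Real.negMulLog] at hη ⊢
  constructor
  · have h1 : s * Real.log s ≤ s * Real.log t :=
      mul_le_mul_of_nonneg_left (Real.log_le_log hs0 hst) hs
    have h2 : (t - s) * Real.log (t - s) ≤ (t - s) * Real.log t := by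
      rcases hd.eq_or_lt with h | h
      · simp [← h]
      · exact mul_le_mul_of_nonneg_left (Real.log_le_log h (by linarith)) hd
    linarith
  · have h1 : s * (Real.log t - Real.log s) ≤ t - s := by
      rw [← Real.log_div ht0.ne' hs0.ne']
      have := mul_le_mul_of_nonneg_left (Real.log_le_sub_one_of_pos (div_pos ht0 hs0)) hs
      rwa [mul_sub, mul_one, mul_div_cancel₀ _ hs0.ne'] at this
    have h2 : (t - s) * Real.log t ≤ 0 :=
      mul_nonpos_of_nonneg_of_nonpos hd (Real.log_nonpos ht ht1)
    linarith

lemma negMulLog_add_le {d N : ℝ} (hd : 0 ≤ d) (hN : 0 < N) :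
    Real.negMulLog d + d ≤ d * Real.log N + 1 / N := by
  rcases hd.eq_or_lt with rfl | hd0
  · simpa using hN.le
  have h := mul_le_mul_of_nonneg_left
    (Real.log_le_sub_one_of_pos (show 0 < 1 / (d * N) by positivity)) hd
  rw [Real.log_div one_ne_zero (by positivity), Real.log_one, Real.log_mul hd0.ne' hN.ne',
    mul_sub, mul_sub, ← mul_div_assoc, mul_one, div_mul_cancel_left₀ hd0.ne',
    inv_eq_one_div] at h
  rw [Real.negMulLog]
  linarith

variable {Ω α β γ : Type*} [Fintype Ω]

lemma abs_hof_sub_hof_le {p q : Ω → ℝ} (hp : IsPMF p) (hq : IsPMF q) (f : Ω → β) :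
    |Hof p f - Hof q f| * Real.log 2 ≤ 1 + (∑ ω, |p ω - q ω|) * Real.log (Fintype.card Ω) := by
  have hl2 : 0 < Real.log 2 := Real.log_pos one_lt_two
  have hne : Nonempty Ω := by
    by_contra h
    rw [not_nonempty_iff] at h
    simpa using hp.2
  have hN : (0 : ℝ) < Fintype.card Ω := by exact_mod_cast Fintype.card_pos
  have hN1 : (1 : ℝ) ≤ Fintype.card Ω := by exact_mod_cast Fintype.card_pos
  have hdiff : ∑ b ∈ Finset.univ.image f, |marg p f b - marg q f b| ≤ ∑ ω, |p ω - q ω| := by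
    rw [← Finset.sum_fiberwise_of_maps_to (s := Finset.univ) (t := Finset.univ.image f) (g := f)
      (fun x _ => Finset.mem_image_of_mem _ (Finset.mem_univ x))]
    refine Finset.sum_le_sum fun b _ => ?_
    rw [marg, marg, ← Finset.sum_sub_distrib]
    exact Finset.abs_sum_le_sum_abs _ _
  rw [hof_eq_sum_image, hof_eq_sum_image, ← sub_div, ← Finset.sum_sub_distrib, abs_div,
    abs_of_pos hl2, div_mul_cancel₀ _ hl2.ne']
  calc |∑ b ∈ Finset.univ.image f, (Real.negMulLog (marg p f b) - Real.negMulLog (marg q f b))|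
      ≤ ∑ b ∈ Finset.univ.image f,
          |Real.negMulLog (marg p f b) - Real.negMulLog (marg q f b)| :=
        Finset.abs_sum_le_sum_abs _ _
    _ ≤ ∑ b ∈ Finset.univ.image f, (|marg p f b - marg q f b| * Real.log (Fintype.card Ω)
          + 1 / Fintype.card Ω) :=
        Finset.sum_le_sum fun b _ => (abs_negMulLog_sub_le (marg_nonneg hp.1 f b)
          (marg_le_one hp f b) (marg_nonneg hq.1 f b) (marg_le_one hq f b)).trans
          (negMulLog_add_le (abs_nonneg _) hN)
    _ = (∑ b ∈ Finset.univ.image f, |marg p f b - marg q f b|) * Real.log (Fintype.card Ω)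
          + (Finset.univ.image f).card / Fintype.card Ω := by
        rw [Finset.sum_add_distrib, Finset.sum_mul, Finset.sum_const, nsmul_eq_mul, mul_one_div]
    _ ≤ (∑ ω, |p ω - q ω|) * Real.log (Fintype.card Ω) + 1 := by
        refine add_le_add (mul_le_mul_of_nonneg_right hdiff (Real.log_nonneg hN1)) ?_
        rw [div_le_one hN]
        exact_mod_cast Finset.card_image_le
    _ = _ := add_comm _ _

/-- Continuity of conditional mutual information in total variation. -/
lemma cmi_mul_log_two_le {p q : Ω → ℝ} (hp : IsPMF p) (hq : IsPMF q)
    (A : Ω → α) (B : Ω → β) (C : Ω → γ) :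
    cmi p A B C * Real.log 2 ≤ cmi q A B C * Real.log 2
      + 4 * (1 + (∑ ω, |p ω - q ω|) * Real.log (Fintype.card Ω)) := by
  have hl2 : 0 < Real.log 2 := Real.log_pos one_lt_two
  have h1 := abs_hof_sub_hof_le hp hq (fun ω => (A ω, B ω))
  have h2 := abs_hof_sub_hof_le hp hq (fun ω => (B ω, C ω))
  have h3 := abs_hof_sub_hof_le hp hq B
  have h4 := abs_hof_sub_hof_le hp hq (fun ω => (A ω, B ω, C ω))
  have k1 := mul_le_mul_of_nonneg_right
    (le_abs_self (Hof p (fun ω => (A ω, B ω)) - Hof q (fun ω => (A ω, B ω)))) hl2.le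
  have k2 := mul_le_mul_of_nonneg_right
    (le_abs_self (Hof p (fun ω => (B ω, C ω)) - Hof q (fun ω => (B ω, C ω)))) hl2.le
  have k3 := mul_le_mul_of_nonneg_right (neg_abs_le (Hof p B - Hof q B)) hl2.le
  have k4 := mul_le_mul_of_nonneg_right
    (neg_abs_le (Hof p (fun ω => (A ω, B ω, C ω)) - Hof q (fun ω => (A ω, B ω, C ω)))) hl2.le
  simp only [cmi]
  linarith

end Continuity

section RandomBinning

variable {U F M : Type*}

/-- Two distinct points collide under a uniformly random map with probability `1 / |F|`. -/
lemma card_mul_sum_collision [Fintype U] [Fintype F] {u v : U} (huv : u ≠ v) :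
    (Fintype.card F : ℝ) * ∑ φ : U → F, (if φ u = φ v then (1 : ℝ) else 0)
      = Fintype.card (U → F) := by
  have h1 : ∀ g : F → ({j // j ≠ u} → F) → ℝ,
      ∑ φ : U → F, g (φ u) (fun j => φ j) = ∑ r : {j // j ≠ u} → F, ∑ a, g a r := by
    intro g
    rw [← Finset.sum_product_right', Finset.univ_product_univ]
    exact Fintype.sum_equiv (Equiv.piSplitAt u (fun _ => F)) _ (fun t => g t.1 t.2)
      fun φ => rfl
  have h2 := h1 fun a r => if a = r ⟨v, huv.symm⟩ then 1 else 0
  have h3 := h1 fun _ _ => 1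
  simp only [Finset.sum_ite_eq', Finset.mem_univ, if_true, Finset.sum_const, nsmul_eq_mul,
    mul_one] at h2 h3
  rw [Finset.card_univ] at h2 h3
  rw [h2, h3, mul_comm, Finset.card_univ, Finset.card_univ]

/-- Leftover hash lemma: a random binning of a source with small conditional probabilities is
close to uniform. -/
lemma sum_abs_one_sub_card_mul_marg_le [Fintype U] [Fintype F] [Nonempty F] {K : U → ℝ}
    (hK : IsPMF K) {γ s : ℝ} (hγ : 0 ≤ γ) (hs : 0 < s) :
    ∑ φ : U → F, ∑ f, |1 - Fintype.card F * marg K φ f|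
      ≤ Fintype.card (U → F) * Fintype.card F *
        (s / 2 + (Fintype.card F - 1) * γ / (2 * s)
          + 2 * ∑ u, if γ < K u then K u else 0) := by
  set N : ℝ := (Fintype.card F : ℝ) with hN
  have hNpos : 0 < N := by rw [hN]; exact_mod_cast Fintype.card_pos
  have hN1 : 1 ≤ N := by rw [hN]; exact_mod_cast Fintype.card_pos
  set K1 : U → ℝ := fun u => if γ < K u then 0 else K u with hK1
  set K2 : U → ℝ := fun u => if γ < K u then K u else 0 with hK2
  set c : ℝ := ∑ u, K1 u with hc
  have hK1nn : ∀ u, 0 ≤ K1 u := fun u => by simp only [hK1]; split_ifs; exacts [le_rfl, hK.1 u]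
  have hK2nn : ∀ u, 0 ≤ K2 u := fun u => by simp only [hK2]; split_ifs; exacts [hK.1 u, le_rfl]
  have hK12 : ∀ u, K u = K1 u + K2 u := fun u => by simp only [hK1, hK2]; split_ifs <;> simp
  have hc2 : 1 = c + ∑ u, K2 u := by
    rw [hc, ← Finset.sum_add_distrib, ← hK.2]
    exact Finset.sum_congr rfl fun u _ => hK12 u
  have hmarg : ∀ (φ : U → F) f, marg K φ f = marg K1 φ f + marg K2 φ f := by
    intro φ f
    rw [marg, marg, marg, ← Finset.sum_add_distrib]
    exact Finset.sum_congr rfl fun u _ => hK12 u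
  have hsq : ∀ φ : U → F, ∑ f, marg K1 φ f ^ 2
      = ∑ u, ∑ v, K1 u * K1 v * (if φ u = φ v then 1 else 0) := by
    intro φ
    simp_rw [pow_two]
    rw [sum_marg_mul]
    refine Finset.sum_congr rfl fun u _ => ?_
    rw [marg_eq_sum_ite, Finset.mul_sum]
    refine Finset.sum_congr rfl fun v _ => ?_
    by_cases h : φ u = φ v
    · simp [h]
    · simp [h, Ne.symm h]
  have havg : ∑ φ : U → F, ∑ f, marg K1 φ f ^ 2
      ≤ Fintype.card (U → F) * (c ^ 2 / N + (1 - 1 / N) * γ) := by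
    set T : ℝ := (Fintype.card (U → F) : ℝ) with hT
    have hT0 : 0 ≤ T := by positivity
    simp_rw [hsq]
    rw [Finset.sum_comm]
    have hpair : ∀ u v, ∑ φ : U → F, K1 u * K1 v * (if φ u = φ v then (1 : ℝ) else 0)
        = K1 u * K1 v * (T / N) + if u = v then K1 u * K1 v * (T * (1 - 1 / N)) else 0 := by
      intro u v
      rw [← Finset.mul_sum]
      by_cases h : u = v
      · subst h
        simp only [if_true, Finset.sum_const, nsmul_eq_mul, mul_one, Finset.card_univ, ← hT]
        ring
      · have := card_mul_sum_collision (F := F) h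
        rw [← hN, ← hT] at this
        rw [if_neg h, add_zero, ← this, mul_div_cancel_left₀ _ hNpos.ne']
    have hdiag : ∑ u, K1 u * K1 u ≤ γ := by
      have hle : ∀ u, K1 u * K1 u ≤ γ * K1 u := fun u => by
        refine mul_le_mul_of_nonneg_right ?_ (hK1nn u)
        simp only [hK1]
        split_ifs with h
        exacts [hγ, not_lt.mp h]
      have hc1 : c ≤ 1 := hc2 ▸ le_add_of_nonneg_right (Finset.sum_nonneg fun u _ => hK2nn u)
      calc ∑ u, K1 u * K1 u ≤ ∑ u, γ * K1 u := Finset.sum_le_sum fun u _ => hle u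
        _ = γ * c := by rw [hc, Finset.mul_sum]
        _ ≤ γ := mul_le_of_le_one_right hγ hc1
    have hexp : ∑ u, ∑ φ : U → F, ∑ v, K1 u * K1 v * (if φ u = φ v then (1 : ℝ) else 0)
        = c ^ 2 * (T / N) + (∑ u, K1 u * K1 u) * (T * (1 - 1 / N)) := by
      simp_rw [Finset.sum_comm (s := (Finset.univ : Finset (U → F))), hpair,
        Finset.sum_add_distrib]
      congr 1
      · rw [pow_two, hc, Finset.sum_mul_sum, Finset.sum_mul]
        exact Finset.sum_congr rfl fun u _ => by rw [Finset.sum_mul]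
      · simp only [Finset.sum_ite_eq, Finset.mem_univ, if_true, Finset.sum_mul]
    rw [hexp]
    have h1N : 0 ≤ 1 - 1 / N := by
      rw [sub_nonneg, div_le_one hNpos]; exact hN1
    have := mul_le_mul_of_nonneg_right hdiag (mul_nonneg hT0 h1N)
    calc _ ≤ c ^ 2 * (T / N) + γ * (T * (1 - 1 / N)) := by linarith
      _ = _ := by ring
  have hφ : ∀ φ : U → F, ∑ f, |1 - N * marg K φ f|
      ≤ N * s / 2 + (N ^ 2 * ∑ f, marg K1 φ f ^ 2 - N * c ^ 2) / (2 * s)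
        + 2 * N * ∑ u, K2 u := by
    intro φ
    have hpt : ∀ f, |1 - N * marg K φ f| ≤ (s + (c - N * marg K1 φ f) ^ 2 / s) / 2
        + ∑ u, K2 u + N * marg K2 φ f := by
      intro f
      have hm2 : 0 ≤ N * marg K2 φ f := mul_nonneg hNpos.le (marg_nonneg hK2nn φ f)
      have hk2 : 0 ≤ ∑ u, K2 u := Finset.sum_nonneg fun u _ => hK2nn u
      have hsplit : 1 - N * marg K φ f
          = (c - N * marg K1 φ f) + ∑ u, K2 u - N * marg K2 φ f := by
        rw [hmarg]; linarith
      have hamgm : |c - N * marg K1 φ f| ≤ (s + (c - N * marg K1 φ f) ^ 2 / s) / 2 := by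
        rw [le_div_iff₀ two_pos, ← sub_nonneg]
        have : s + (c - N * marg K1 φ f) ^ 2 / s - |c - N * marg K1 φ f| * 2
            = (|c - N * marg K1 φ f| - s) ^ 2 / s := by
          rw [← sq_abs (c - N * marg K1 φ f)]
          field_simp
          ring
        rw [this]
        positivity
      rw [hsplit]
      have h1 := le_abs_self (c - N * marg K1 φ f)
      have h2 := neg_abs_le (c - N * marg K1 φ f)
      rw [abs_le]
      constructor <;> linarith
    refine (Finset.sum_le_sum fun f _ => hpt f).trans_eq ?_
    have e1 : ∑ f, (c - N * marg K1 φ f) ^ 2 = N ^ 2 * ∑ f, marg K1 φ f ^ 2 - N * c ^ 2 := by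
      have : ∀ f, (c - N * marg K1 φ f) ^ 2
          = c ^ 2 - 2 * c * N * marg K1 φ f + N ^ 2 * marg K1 φ f ^ 2 := fun f => by ring
      simp_rw [this, Finset.sum_add_distrib, Finset.sum_sub_distrib, ← Finset.mul_sum]
      rw [sum_marg, Finset.sum_const, nsmul_eq_mul, Finset.card_univ, ← hN, ← hc]
      ring
    rw [Finset.sum_add_distrib, Finset.sum_add_distrib, ← Finset.sum_div,
      Finset.sum_add_distrib, ← Finset.sum_div, e1, ← Finset.mul_sum, sum_marg]
    simp only [Finset.sum_const, nsmul_eq_mul, Finset.card_univ, ← hN]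
    ring
  refine (Finset.sum_le_sum fun φ _ => hφ φ).trans ?_
  simp only [Finset.sum_add_distrib, Finset.sum_const, nsmul_eq_mul, Finset.card_univ,
    ← Finset.sum_div, Finset.sum_sub_distrib, ← Finset.mul_sum]
  set T : ℝ := (Fintype.card (U → F) : ℝ) with hT
  have hfin : (N ^ 2 * ∑ φ : U → F, ∑ f, marg K1 φ f ^ 2 - T * (N * c ^ 2)) / (2 * s)
      ≤ T * N * ((N - 1) * γ / (2 * s)) := by
    rw [div_le_iff₀ (by positivity)]
    have := mul_le_mul_of_nonneg_left havg (sq_nonneg N)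
    have e : N ^ 2 * (T * (c ^ 2 / N + (1 - 1 / N) * γ)) - T * (N * c ^ 2)
        = T * N * ((N - 1) * γ) := by
      field_simp
      ring
    have e' : T * N * ((N - 1) * γ / (2 * s)) * (2 * s) = T * N * ((N - 1) * γ) := by
      field_simp
    rw [e', ← e]
    linarith
  linarith

/-- Bin decoder: some element of the candidate set `S` whose bins are `f` and `m`. -/
noncomputable def binDecode [Nonempty U] (S : Finset U) (φ : U → F) (ψ : U → M) (f : F) (m : M) :
    U :=
  if h : ∃ u ∈ S, φ u = f ∧ ψ u = m then h.choose else Classical.arbitrary U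

lemma binDecode_error_le [Nonempty U] (S : Finset U) (φ : U → F) (ψ : U → M) (u : U) :
    (if binDecode S φ ψ (φ u) (ψ u) ≠ u then (1 : ℝ) else 0)
      ≤ (if u ∉ S then 1 else 0)
        + ∑ v ∈ S.erase u, (if φ u = φ v then 1 else 0) * (if ψ u = ψ v then 1 else 0) := by
  have hnn : ∀ v ∈ S.erase u, (0 : ℝ) ≤
      (if φ u = φ v then 1 else 0) * (if ψ u = ψ v then 1 else 0) := fun v _ => by
    split_ifs <;> norm_num
  by_cases hu : u ∈ S
  · have h : ∃ v ∈ S, φ v = φ u ∧ ψ v = ψ u := ⟨u, hu, rfl, rfl⟩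
    have hd : binDecode S φ ψ (φ u) (ψ u) = h.choose := dif_pos h
    obtain ⟨h1, h2, h3⟩ := h.choose_spec
    rw [hd]
    split_ifs with hne
    · refine le_add_of_nonneg_of_le le_rfl ?_
      refine le_trans ?_ (Finset.single_le_sum hnn (Finset.mem_erase.mpr ⟨hne, h1⟩))
      rw [if_pos h2.symm, if_pos h3.symm, mul_one]
    · exact add_nonneg le_rfl (Finset.sum_nonneg hnn)
  · rw [if_pos hu]
    have := Finset.sum_nonneg hnn
    split_ifs <;> linarith

/-- Random binning (Slepian-Wolf) error bound. -/
lemma sum_binDecode_error_le [Fintype U] [Fintype F] [Fintype M] [Nonempty U] [Nonempty F]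
    [Nonempty M] (S : Finset U) (u : U) :
    ∑ φ : U → F, ∑ ψ : U → M, (if binDecode S φ ψ (φ u) (ψ u) ≠ u then (1 : ℝ) else 0)
      ≤ Fintype.card (U → F) * Fintype.card (U → M) * ((if u ∉ S then 1 else 0)
        + S.card / (Fintype.card F * Fintype.card M)) := by
  have hF : (0 : ℝ) < Fintype.card F := by exact_mod_cast Fintype.card_pos
  have hM : (0 : ℝ) < Fintype.card M := by exact_mod_cast Fintype.card_pos
  refine (Finset.sum_le_sum fun φ _ => Finset.sum_le_sum fun ψ _ =>
    binDecode_error_le S φ ψ u).trans ?_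
  have hv : ∀ v ∈ S.erase u, ∑ φ : U → F, ∑ ψ : U → M,
      (if φ u = φ v then (1 : ℝ) else 0) * (if ψ u = ψ v then 1 else 0)
      = Fintype.card (U → F) * Fintype.card (U → M) / (Fintype.card F * Fintype.card M) := by
    intro v hv
    have hne := (Finset.ne_of_mem_erase hv).symm
    rw [← Finset.sum_mul_sum, ← card_mul_sum_collision (F := F) hne,
      ← card_mul_sum_collision (F := M) hne]
    field_simp
  simp only [Finset.sum_add_distrib, Finset.sum_const, nsmul_eq_mul, Finset.card_univ]
  have hswap : ∑ φ : U → F, ∑ ψ : U → M, ∑ v ∈ S.erase u,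
      (if φ u = φ v then (1 : ℝ) else 0) * (if ψ u = ψ v then 1 else 0)
      = ∑ v ∈ S.erase u, ∑ φ : U → F, ∑ ψ : U → M,
      (if φ u = φ v then (1 : ℝ) else 0) * (if ψ u = ψ v then 1 else 0) := by
    simp_rw [Finset.sum_comm (s := (Finset.univ : Finset (U → M))) (t := S.erase u)]
    rw [Finset.sum_comm]
  rw [hswap, Finset.sum_congr rfl hv, Finset.sum_const, nsmul_eq_mul, ← mul_assoc, mul_add]
  refine add_le_add le_rfl ?_
  have hcard : ((S.erase u).card : ℝ) ≤ S.card := by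
    exact_mod_cast Finset.card_le_card (Finset.erase_subset _ _)
  calc _ ≤ (S.card : ℝ) * (Fintype.card (U → F) * Fintype.card (U → M)
        / (Fintype.card F * Fintype.card M)) :=
        mul_le_mul_of_nonneg_right hcard (by positivity)
    _ = _ := by ring

end RandomBinning

section OneShot

variable {X Y Z U F M : Type*}

/-- The pmf `K` conditioned on the event `φ = f`, or `K` itself if this event is null. -/
noncomputable def condOn [Fintype U] (K : U → ℝ) (φ : U → F) (f : F) (u : U) : ℝ :=
  if marg K φ f = 0 then K u else (if φ u = f then K u else 0) / marg K φ f

lemma isPMF_condOn [Fintype U] {K : U → ℝ} (hK : IsPMF K) (φ : U → F) (f : F) :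
    IsPMF (condOn K φ f) := by
  by_cases h : marg K φ f = 0
  · have : condOn K φ f = K := funext fun u => if_pos h
    rwa [this]
  · have : condOn K φ f = fun u => (if φ u = f then K u else 0) / marg K φ f :=
      funext fun u => if_neg h
    rw [this]
    refine ⟨fun u => div_nonneg ?_ (marg_nonneg hK.1 φ f), ?_⟩
    · split_ifs
      exacts [hK.1 u, le_rfl]
    · rw [← Finset.sum_div, ← marg_eq_sum_ite, div_self h]

lemma sum_abs_condOn_sub_le [Fintype U] {K : U → ℝ} (hK : IsPMF K) (φ : U → F) (f : F) (N : ℝ) :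
    ∑ u, |condOn K φ f u - N * (if φ u = f then K u else 0)| ≤ |1 - N * marg K φ f| := by
  have hnn : ∀ u, 0 ≤ if φ u = f then K u else 0 := fun u => by
    split_ifs
    exacts [hK.1 u, le_rfl]
  by_cases h : marg K φ f = 0
  · have h' := h
    rw [marg_eq_sum_ite, Finset.sum_eq_zero_iff_of_nonneg fun u _ => hnn u] at h'
    have : ∀ u, |condOn K φ f u - N * (if φ u = f then K u else 0)| = K u := fun u => by
      rw [h' u (Finset.mem_univ u), mul_zero, sub_zero, condOn, if_pos h, abs_of_nonneg (hK.1 u)]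
    simp only [this, hK.2, h, mul_zero, sub_zero, abs_one, le_refl]
  · have : ∀ u, |condOn K φ f u - N * (if φ u = f then K u else 0)|
        = (if φ u = f then K u else 0) * |(marg K φ f)⁻¹ - N| := fun u => by
      rw [condOn, if_neg h, div_eq_mul_inv, mul_comm N, ← mul_sub, abs_mul,
        abs_of_nonneg (hnn u)]
    simp only [this]
    rw [← Finset.sum_mul, ← marg_eq_sum_ite]
    nth_rewrite 1 [← abs_of_nonneg (marg_nonneg hK.1 φ f)]
    rw [← abs_mul, mul_sub, mul_inv_cancel₀ h, mul_comm N]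

variable [Fintype X] [Fintype Y] [Fintype Z] [Fintype U] [Fintype M]

/-- Distance between the law induced by a binning code with fixed bin index `f` and an ideal law
in which the message is a channel output of `(Y, Z)`. -/
lemma sum_abs_binning_sub_le {p : X → Y → ℝ} {A : X → U → ℝ} {B : U → Y → Z → ℝ}
    {Q : X → Y → Z → ℝ} {C : Y → Z → U → ℝ} (hp : ∀ x y, 0 ≤ p x y)
    (hA : ∀ x, IsPMF (A x)) (hB : ∀ u y, IsPMF (B u y)) (hQ : ∀ x y, IsPMF (Q x y))
    (hC : ∀ y z, IsPMF (C y z))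
    (h : ∀ x y z u, p x y * A x u * B u y z = p x y * Q x y z * C y z u)
    (φ : U → F) (ψ : U → M) (f : F) (d : M → Y → U) {N : ℝ} (hN : 0 ≤ N) :
    ∑ x, ∑ y, ∑ z, ∑ m, |p x y * marg (condOn (A x) φ f) ψ m * B (d m y) y z
        - p x y * Q x y z * marg (condOn (C y z) φ f) ψ m|
      ≤ ∑ x, ∑ y, (p x y * |1 - N * marg (A x) φ f|
        + 2 * N * ∑ u, p x y * A x u *
            (if φ u = f then if d (ψ u) y ≠ u then 1 else 0 else 0)
        + ∑ z, p x y * Q x y z * |1 - N * marg (C y z) φ f|) := by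
  refine Finset.sum_le_sum fun x _ => Finset.sum_le_sum fun y _ => ?_
  set a : U → ℝ := fun u => N * (if φ u = f then A x u else 0) with ha
  have ha0 : ∀ u, 0 ≤ a u := fun u => by
    refine mul_nonneg hN ?_
    split_ifs
    exacts [(hA x).1 u, le_rfl]
  set c : Z → U → ℝ := fun z u => N * (if φ u = f then C y z u else 0) with hc
  have hac : ∀ z u, p x y * a u * B u y z = p x y * Q x y z * c z u := fun z u => by
    by_cases hu : φ u = f
    · simp only [ha, hc, hu, if_true]
      linear_combination N * h x y z u
    · simp [ha, hc, hu]
  have hpt : ∀ z m, |p x y * marg (condOn (A x) φ f) ψ m * B (d m y) y z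
        - p x y * Q x y z * marg (condOn (C y z) φ f) ψ m|
      ≤ ∑ u, if ψ u = m then
          p x y * |condOn (A x) φ f u - a u| * B (d (ψ u) y) y z
          + p x y * a u * |B (d (ψ u) y) y z - B u y z|
          + p x y * Q x y z * |condOn (C y z) φ f u - c z u| else 0 := by
    intro z m
    rw [marg_eq_sum_ite, marg_eq_sum_ite, Finset.mul_sum, Finset.sum_mul, Finset.mul_sum,
      ← Finset.sum_sub_distrib]
    refine (Finset.abs_sum_le_sum_abs _ _).trans (Finset.sum_le_sum fun u _ => ?_)
    by_cases hu : ψ u = m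
    · simp only [hu, if_true]
      have e : p x y * condOn (A x) φ f u * B (d m y) y z
          - p x y * Q x y z * condOn (C y z) φ f u
          = p x y * (condOn (A x) φ f u - a u) * B (d m y) y z
            + p x y * a u * (B (d m y) y z - B u y z)
            - p x y * Q x y z * (condOn (C y z) φ f u - c z u) := by
        linear_combination hac z u
      rw [e]
      refine (abs_sub _ _).trans (add_le_add ((abs_add_le _ _).trans_eq ?_) (le_of_eq ?_))
      · rw [abs_mul, abs_mul, abs_mul, abs_mul, abs_of_nonneg (hp x y),
          abs_of_nonneg ((hB _ y).1 z), abs_of_nonneg (ha0 u)]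
      · rw [abs_mul, abs_mul, abs_of_nonneg (hp x y), abs_of_nonneg ((hQ x y).1 z)]
    · simp [hu]
  have hm : ∀ z, ∑ m, |p x y * marg (condOn (A x) φ f) ψ m * B (d m y) y z
        - p x y * Q x y z * marg (condOn (C y z) φ f) ψ m|
      ≤ ∑ u, (p x y * |condOn (A x) φ f u - a u| * B (d (ψ u) y) y z
          + p x y * a u * |B (d (ψ u) y) y z - B u y z|
          + p x y * Q x y z * |condOn (C y z) φ f u - c z u|) := by
    intro z
    refine (Finset.sum_le_sum fun m _ => hpt z m).trans_eq ?_
    rw [Finset.sum_comm]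
    exact Finset.sum_congr rfl fun u _ => by simp
  refine (Finset.sum_le_sum fun z _ => hm z).trans ?_
  simp only [Finset.sum_add_distrib]
  refine add_le_add (add_le_add ?_ ?_) ?_
  · rw [Finset.sum_comm]
    simp only [← Finset.mul_sum, (hB _ y).2, mul_one]
    exact mul_le_mul_of_nonneg_left (sum_abs_condOn_sub_le (hA x) φ f N) (hp x y)
  · rw [Finset.sum_comm, Finset.mul_sum]
    refine Finset.sum_le_sum fun u _ => ?_
    rw [← Finset.mul_sum]
    have hB2 : ∑ z, |B (d (ψ u) y) y z - B u y z| ≤ if d (ψ u) y ≠ u then 2 else 0 := by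
      split_ifs with hd
      · refine (Finset.sum_le_sum fun z _ => abs_sub _ _).trans_eq ?_
        simp only [abs_of_nonneg ((hB _ y).1 _), Finset.sum_add_distrib, (hB _ y).2]
        norm_num
      · rw [not_not.mp hd]
        simp
    refine (mul_le_mul_of_nonneg_left hB2 (mul_nonneg (hp x y) (ha0 u))).trans_eq ?_
    simp only [ha]
    split_ifs <;> ring
  · refine Finset.sum_le_sum fun z _ => ?_
    rw [← Finset.mul_sum]
    exact mul_le_mul_of_nonneg_left (sum_abs_condOn_sub_le (hC y z) φ f N)
      (mul_nonneg (hp x y) ((hQ x y).1 z))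

lemma sum_weighted_sum_le {ι τ : Type*} [Fintype ι] [Fintype τ] {w c : τ → ℝ} {g : τ → ι → ℝ}
    (hw : ∀ t, 0 ≤ w t) (hg : ∀ t, ∑ i, g t i ≤ c t) :
    ∑ i, ∑ t, w t * g t i ≤ ∑ t, w t * c t := by
  rw [Finset.sum_comm]
  simp_rw [← Finset.mul_sum]
  exact Finset.sum_le_sum fun t _ => mul_le_mul_of_nonneg_left (hg t) (hw t)

/-- One-shot achievability by random binning: there is a code whose induced law is close to
`p(x, y) Q(z | x, y) κ(m | y, z)`. -/
lemma exists_code_sum_abs_le [Nonempty U] [Nonempty M] [Fintype F] [Nonempty F]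
    {p : X → Y → ℝ} {A : X → U → ℝ} {B : U → Y → Z → ℝ}
    {Q : X → Y → Z → ℝ} {C : Y → Z → U → ℝ} {D : Y → U → ℝ} (hp : ∀ x y, 0 ≤ p x y)
    (hp1 : ∑ x, ∑ y, p x y = 1)
    (hA : ∀ x, IsPMF (A x)) (hB : ∀ u y, IsPMF (B u y)) (hQ : ∀ x y, IsPMF (Q x y))
    (hC : ∀ y z, IsPMF (C y z)) (hD : ∀ y, IsPMF (D y))
    (h : ∀ x y z u, p x y * A x u * B u y z = p x y * Q x y z * C y z u)
    {γ δ s : ℝ} (hγ : 0 ≤ γ) (hδ : 0 < δ) (hs : 0 < s) :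
    ∃ (enc : X → M → ℝ) (dec : M → Y → Z → ℝ) (κ : Y → Z → M → ℝ),
      (∀ x, IsPMF (enc x)) ∧ (∀ m y, IsPMF (dec m y)) ∧ (∀ y z, IsPMF (κ y z)) ∧
      ∑ x, ∑ y, ∑ z, ∑ m, |p x y * enc x m * dec m y z - p x y * Q x y z * κ y z m|
        ≤ 2 * (s / 2 + (Fintype.card F - 1) * γ / (2 * s)
            + 2 * ∑ x, ∑ y, ∑ z, ∑ u, if γ < C y z u then p x y * Q x y z * C y z u else 0)
          + 2 * ((∑ x, ∑ y, ∑ u, if D y u < δ then p x y * A x u else 0)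
            + 1 / (δ * (Fintype.card F * Fintype.card M))) := by
  set N : ℝ := (Fintype.card F : ℝ) with hN
  have hNpos : 0 < N := by rw [hN]; exact_mod_cast Fintype.card_pos
  have hMpos : (0 : ℝ) < Fintype.card M := by exact_mod_cast Fintype.card_pos
  set S : Y → Finset U := fun y => Finset.univ.filter fun u => δ ≤ D y u with hS
  have hScard : ∀ y, ((S y).card : ℝ) ≤ 1 / δ := by
    intro y
    rw [le_div_iff₀ hδ, ← nsmul_eq_mul, ← Finset.sum_const, ← (hD y).2]
    refine (Finset.sum_le_sum fun u hu => (Finset.mem_filter.mp hu).2).trans ?_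
    exact Finset.sum_le_sum_of_subset_of_nonneg (Finset.subset_univ _) fun u _ _ => (hD y).1 u
  set w3 : X × Y × Z → ℝ := fun t => p t.1 t.2.1 * Q t.1 t.2.1 t.2.2 with hw3
  set wu : X × Y × U → ℝ := fun t => p t.1 t.2.1 * A t.1 t.2.2 with hwu
  have hw3nn : ∀ t, 0 ≤ w3 t := fun t => mul_nonneg (hp _ _) ((hQ _ _).1 _)
  have hwunn : ∀ t, 0 ≤ wu t := fun t => mul_nonneg (hp _ _) ((hA _).1 _)
  have hw3sum : ∑ t, w3 t = 1 := by
    simp only [hw3, Fintype.sum_prod_type, ← Finset.mul_sum, (hQ _ _).2, mul_one, hp1]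
  have hwusum : ∑ t, wu t = 1 := by
    simp only [hwu, Fintype.sum_prod_type, ← Finset.mul_sum, (hA _).2, mul_one, hp1]
  set T : ℝ := (Fintype.card (U → F) : ℝ) * Fintype.card (U → M) with hT
  have hTpos : 0 < T := by
    rw [hT, ← Nat.cast_mul]
    exact_mod_cast Nat.mul_pos Fintype.card_pos Fintype.card_pos
  set g3 : X × Y × Z → (U → F) × (U → M) × F → ℝ :=
    fun t i => |1 - N * marg (C t.2.1 t.2.2) i.1 i.2.2| with hg3
  set gu : X × Y × U → (U → F) × (U → M) × F → ℝ := fun t i =>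
    if i.1 t.2.2 = i.2.2 then
      if binDecode (S t.2.1) i.1 i.2.1 i.2.2 (i.2.1 t.2.2) ≠ t.2.2 then 1 else 0 else 0 with hgu
  set b : ℝ := 2 * (s / 2 + (N - 1) * γ / (2 * s)
            + 2 * ∑ x, ∑ y, ∑ z, ∑ u, if γ < C y z u then p x y * Q x y z * C y z u else 0)
          + 2 * ((∑ x, ∑ y, ∑ u, if D y u < δ then p x y * A x u else 0)
            + 1 / (δ * (N * Fintype.card M))) with hb
  have hsum3 : ∑ i, ∑ t, w3 t * g3 t i ≤ T * N * (s / 2 + (N - 1) * γ / (2 * s)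
            + 2 * ∑ x, ∑ y, ∑ z, ∑ u,
              if γ < C y z u then p x y * Q x y z * C y z u else 0) := by
    refine (sum_weighted_sum_le hw3nn (c := fun t => T * N * (s / 2 + (N - 1) * γ / (2 * s)
      + 2 * ∑ u, if γ < C t.2.1 t.2.2 u then C t.2.1 t.2.2 u else 0)) fun t => ?_).trans_eq ?_
    · have := sum_abs_one_sub_card_mul_marg_le (F := F) (hC t.2.1 t.2.2) hγ hs
      simp only [hg3, Fintype.sum_prod_type, Finset.sum_const, nsmul_eq_mul, Finset.card_univ,
        ← Finset.mul_sum]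
      refine (mul_le_mul_of_nonneg_left this (Nat.cast_nonneg _)).trans_eq ?_
      rw [hT]
      ring
    · have e : ∀ t : X × Y × Z, w3 t * (T * N * (s / 2 + (N - 1) * γ / (2 * s)
          + 2 * ∑ u, if γ < C t.2.1 t.2.2 u then C t.2.1 t.2.2 u else 0))
          = w3 t * (T * N * (s / 2 + (N - 1) * γ / (2 * s)))
            + T * N * 2 * ∑ u, if γ < C t.2.1 t.2.2 u then w3 t * C t.2.1 t.2.2 u else 0 := by
        intro t
        have : ∑ u, (if γ < C t.2.1 t.2.2 u then w3 t * C t.2.1 t.2.2 u else 0)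
            = w3 t * ∑ u, if γ < C t.2.1 t.2.2 u then C t.2.1 t.2.2 u else 0 := by
          rw [Finset.mul_sum]
          exact Finset.sum_congr rfl fun u _ => by rw [mul_ite, mul_zero]
        rw [this]
        ring
      simp only [e, Finset.sum_add_distrib, ← Finset.sum_mul, ← Finset.mul_sum, hw3sum]
      simp only [hw3, Fintype.sum_prod_type]
      ring
  have hsumu : ∑ i, ∑ t, wu t * gu t i ≤ T *
      ((∑ x, ∑ y, ∑ u, if D y u < δ then p x y * A x u else 0)
            + 1 / (δ * (N * Fintype.card M))) := by
    refine (sum_weighted_sum_le hwunn (c := fun t => T * ((if t.2.2 ∉ S t.2.1 then 1 else 0)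
      + 1 / (δ * (N * Fintype.card M)))) fun t => ?_).trans_eq ?_
    · have := sum_binDecode_error_le (F := F) (M := M) (S t.2.1) t.2.2
      simp only [hgu, Fintype.sum_prod_type, Finset.sum_ite_eq, Finset.mem_univ, if_true]
      refine this.trans ?_
      rw [← hT]
      refine mul_le_mul_of_nonneg_left (add_le_add le_rfl ?_) hTpos.le
      rw [← div_div 1 δ, ← hN]
      exact div_le_div_of_nonneg_right (hScard _) (mul_pos hNpos hMpos).le
    · have e : ∀ t : X × Y × U, wu t * (T * ((if t.2.2 ∉ S t.2.1 then 1 else 0)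
          + 1 / (δ * (N * Fintype.card M))))
          = T * (if D t.2.1 t.2.2 < δ then wu t else 0)
            + wu t * (T * (1 / (δ * (N * Fintype.card M)))) := by
        intro t
        have : t.2.2 ∉ S t.2.1 ↔ D t.2.1 t.2.2 < δ := by simp [hS]
        simp only [this]
        split_ifs <;> ring
      simp only [e, Finset.sum_add_distrib, ← Finset.sum_mul, ← Finset.mul_sum, hwusum]
      simp only [hwu, Fintype.sum_prod_type]
      ring
  have hex : ∃ i : (U → F) × (U → M) × F,
      2 * ∑ t, w3 t * g3 t i + 2 * N * ∑ t, wu t * gu t i ≤ b := by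
    have htot : ∑ i, (2 * ∑ t, w3 t * g3 t i + 2 * N * ∑ t, wu t * gu t i) ≤ T * N * b := by
      have h3 := mul_le_mul_of_nonneg_left hsumu (mul_nonneg two_pos.le hNpos.le)
      rw [Finset.sum_add_distrib, ← Finset.mul_sum, ← Finset.mul_sum, hb]
      linarith
    have hconst : ∑ _i : (U → F) × (U → M) × F, b = T * N * b := by
      rw [Finset.sum_const, nsmul_eq_mul, Finset.card_univ, Fintype.card_prod, Fintype.card_prod,
        hT, hN]
      push_cast
      ring
    obtain ⟨i, -, hi⟩ := Finset.exists_le_of_sum_le Finset.univ_nonempty (htot.trans_eq hconst.symm)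
    exact ⟨i, hi⟩
  obtain ⟨⟨φ, ψ, f⟩, hi⟩ := hex
  refine ⟨fun x => marg (condOn (A x) φ f) ψ,
    fun m y => B (binDecode (S y) φ ψ f m) y, fun y z => marg (condOn (C y z) φ f) ψ,
    fun x => isPMF_marg (isPMF_condOn (hA x) φ f) ψ, fun m y => hB _ y,
    fun y z => isPMF_marg (isPMF_condOn (hC y z) φ f) ψ, ?_⟩
  refine (sum_abs_binning_sub_le hp hA hB hQ hC h φ ψ f
    (fun m y => binDecode (S y) φ ψ f m) hNpos.le).trans (le_trans ?_ hi)
  have hAC : ∀ x y, p x y * |1 - N * marg (A x) φ f|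
      ≤ ∑ z, p x y * Q x y z * |1 - N * marg (C y z) φ f| := by
    intro x y
    have e : p x y * (1 - N * marg (A x) φ f)
        = ∑ z, p x y * Q x y z * (1 - N * marg (C y z) φ f) := by
      have e1 : p x y * marg (A x) φ f = ∑ z, p x y * Q x y z * marg (C y z) φ f := by
        simp only [marg, Finset.mul_sum, ← h]
        rw [Finset.sum_comm]
        refine Finset.sum_congr rfl fun u _ => ?_
        rw [← Finset.mul_sum, (hB u y).2, mul_one]
      have e2 : p x y = ∑ z, p x y * Q x y z := by rw [← Finset.mul_sum, (hQ x y).2, mul_one]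
      have e3 : ∀ z, p x y * Q x y z * (1 - N * marg (C y z) φ f)
          = p x y * Q x y z - N * (p x y * Q x y z * marg (C y z) φ f) := fun z => by ring
      simp_rw [e3]
      rw [Finset.sum_sub_distrib, ← e2, ← Finset.mul_sum, ← e1]
      ring
    rw [← abs_of_nonneg (hp x y), ← abs_mul, abs_of_nonneg (hp x y), e]
    refine (Finset.abs_sum_le_sum_abs _ _).trans_eq (Finset.sum_congr rfl fun z _ => ?_)
    rw [abs_mul, abs_of_nonneg (mul_nonneg (hp x y) ((hQ x y).1 z))]
  simp only [hw3, hg3, hwu, hgu, Fintype.sum_prod_type]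
  rw [Finset.mul_sum, Finset.mul_sum, ← Finset.sum_add_distrib]
  refine Finset.sum_le_sum fun x _ => ?_
  rw [Finset.mul_sum, Finset.mul_sum, ← Finset.sum_add_distrib]
  refine Finset.sum_le_sum fun y _ => ?_
  linarith [hAC x y]

end OneShot

section ProductSource

variable {Ω α β : Type*}

lemma isPMF_prod [Fintype α] {n : ℕ} {K : Fin n → α → ℝ} (hK : ∀ i, IsPMF (K i)) :
    IsPMF (fun a : Fin n → α => ∏ i, K i (a i)) := by
  refine ⟨fun a => Finset.prod_nonneg fun i _ => (hK i).1 _, ?_⟩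
  have := Finset.prod_univ_sum (fun _ : Fin n => (Finset.univ : Finset α)) K
  rw [Fintype.piFinset_univ] at this
  rw [← this]
  exact Finset.prod_eq_one fun i _ => (hK i).2

lemma sum_arrow_prod [Fintype α] [Fintype β] {n : ℕ} (G : (Fin n → α) → (Fin n → β) → ℝ) :
    ∑ a, ∑ b, G a b = ∑ ω : Fin n → α × β, G (fun i => (ω i).1) (fun i => (ω i).2) := by
  rw [← Finset.sum_product', Finset.univ_product_univ]
  exact (Fintype.sum_equiv (Equiv.arrowProdEquivProdArrow (Fin n) (fun _ => α) fun _ => β) _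
    (fun t => G t.1 t.2) fun _ => rfl).symm

lemma sum_prod_succ [Fintype Ω] (p : Ω → ℝ) (n : ℕ) (G : Ω → (Fin n → Ω) → ℝ) :
    ∑ ω : Fin (n + 1) → Ω, (∏ i, p (ω i)) * G (ω 0) (fun i => ω i.succ)
      = ∑ a, p a * ∑ ω : Fin n → Ω, (∏ i, p (ω i)) * G a ω := by
  rw [← Equiv.sum_comp (Fin.consEquiv fun _ => Ω), Fintype.sum_prod_type]
  refine Finset.sum_congr rfl fun a _ => ?_
  rw [Finset.mul_sum]
  refine Finset.sum_congr rfl fun ω _ => ?_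
  simp [Fin.consEquiv, Fin.prod_univ_succ, mul_assoc]

lemma sum_prod_mul_sum_eq_zero [Fintype Ω] {p g : Ω → ℝ} (hp : IsPMF p)
    (hg : ∑ a, p a * g a = 0) (n : ℕ) :
    ∑ ω : Fin n → Ω, (∏ i, p (ω i)) * ∑ i, g (ω i) = 0 := by
  induction n with
  | zero => simp
  | succ n ih =>
    have h := sum_prod_succ p n fun a ω => g a + ∑ i, g (ω i)
    simp only [Fin.sum_univ_succ]
    rw [h]
    simp only [mul_add, Finset.sum_add_distrib, ih, ← Finset.sum_mul,
      (isPMF_prod (n := n) fun _ => hp).2, one_mul, hg, add_zero]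

lemma sum_prod_mul_sum_sq [Fintype Ω] {p g : Ω → ℝ} (hp : IsPMF p)
    (hg : ∑ a, p a * g a = 0) (n : ℕ) :
    ∑ ω : Fin n → Ω, (∏ i, p (ω i)) * (∑ i, g (ω i)) ^ 2 = n * ∑ a, p a * g a ^ 2 := by
  induction n with
  | zero => simp
  | succ n ih =>
    have h := sum_prod_succ p n fun a ω => (g a + ∑ i, g (ω i)) ^ 2
    simp only [Fin.sum_univ_succ]
    rw [h]
    have e : ∀ a, ∑ ω : Fin n → Ω, (∏ i, p (ω i)) * (g a + ∑ i, g (ω i)) ^ 2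
        = g a ^ 2 + n * ∑ a, p a * g a ^ 2 := by
      intro a
      have e1 : ∀ ω : Fin n → Ω, (∏ i, p (ω i)) * (g a + ∑ i, g (ω i)) ^ 2
          = (∏ i, p (ω i)) * g a ^ 2 + 2 * g a * ((∏ i, p (ω i)) * ∑ i, g (ω i))
            + (∏ i, p (ω i)) * (∑ i, g (ω i)) ^ 2 := fun ω => by ring
      simp_rw [e1, Finset.sum_add_distrib, ih, ← Finset.mul_sum,
        sum_prod_mul_sum_eq_zero hp hg, ← Finset.sum_mul, (isPMF_prod (n := n) fun _ => hp).2]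
      ring
    simp_rw [e, mul_add, Finset.sum_add_distrib, ← Finset.sum_mul, hp.2]
    push_cast
    ring

/-- Chebyshev's inequality for sums over a memoryless source. -/
lemma sum_prod_ite_le [Fintype Ω] {p : Ω → ℝ} (hp : IsPMF p) (g : Ω → ℝ) {δ : ℝ} (hδ : 0 < δ)
    {n : ℕ} (hn : 0 < n) :
    ∑ ω : Fin n → Ω, (if n * δ ≤ |∑ i, g (ω i) - n * ∑ a, p a * g a| then ∏ i, p (ω i) else 0)
      ≤ (∑ a, p a * (g a - ∑ a, p a * g a) ^ 2) / (n * δ ^ 2) := by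
  set μ := ∑ a, p a * g a with hμ
  have hn' : (0 : ℝ) < n := by exact_mod_cast hn
  have hg : ∑ a, p a * (g a - μ) = 0 := by
    simp only [mul_sub, Finset.sum_sub_distrib, ← Finset.sum_mul, hp.2, one_mul, ← hμ, sub_self]
  have hsq := sum_prod_mul_sum_sq hp hg n
  have hpt : ∀ ω : Fin n → Ω,
      (if n * δ ≤ |∑ i, g (ω i) - n * μ| then ∏ i, p (ω i) else 0)
        ≤ (∏ i, p (ω i)) * (∑ i, (g (ω i) - μ)) ^ 2 / (n * δ) ^ 2 := by
    intro ω
    have hP : 0 ≤ ∏ i, p (ω i) := Finset.prod_nonneg fun i _ => hp.1 _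
    have e : ∑ i, (g (ω i) - μ) = ∑ i, g (ω i) - n * μ := by
      rw [Finset.sum_sub_distrib]
      simp
    rw [e]
    split_ifs with h
    · rw [le_div_iff₀ (by positivity)]
      refine mul_le_mul_of_nonneg_left ?_ hP
      rw [← sq_abs (∑ i, g (ω i) - n * μ)]
      exact pow_le_pow_left₀ (by positivity) h 2
    · positivity
  refine (Finset.sum_le_sum fun ω _ => hpt ω).trans_eq ?_
  rw [← Finset.sum_div, hsq]
  field_simp

lemma sum_log_prod_eq {J L : Ω → ℝ} {n : ℕ} (hJ : ∀ a, 0 ≤ J a) (hL : ∀ a, 0 < J a → 0 < L a)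
    {ω : Fin n → Ω} (hω : ∏ i, J (ω i) ≠ 0) :
    ∏ i, L (ω i) = Real.exp (-∑ i, -Real.log (L (ω i))) := by
  rw [Finset.sum_neg_distrib, neg_neg, Real.exp_sum]
  refine Finset.prod_congr rfl fun i _ => (Real.exp_log (hL _ ?_)).symm
  exact (hJ _).lt_of_ne' (Finset.prod_ne_zero_iff.mp hω i (Finset.mem_univ i))

variable [Fintype Ω] {J L : Ω → ℝ}

/-- Atypically large likelihoods are improbable. -/
lemma sum_prod_ite_large_le (hJ : IsPMF J) (hL : ∀ a, 0 < J a → 0 < L a) {δ : ℝ} (hδ : 0 < δ)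
    {n : ℕ} (hn : 0 < n) :
    ∑ ω : Fin n → Ω, (if Real.exp (-(n * (∑ a, J a * -Real.log (L a) - δ))) < ∏ i, L (ω i)
        then ∏ i, J (ω i) else 0)
      ≤ (∑ a, J a * (-Real.log (L a) - ∑ a, J a * -Real.log (L a)) ^ 2) / (n * δ ^ 2) := by
  refine (Finset.sum_le_sum fun ω _ => ?_).trans
    (sum_prod_ite_le hJ (fun a => -Real.log (L a)) hδ hn)
  have hP : 0 ≤ ∏ i, J (ω i) := Finset.prod_nonneg fun i _ => hJ.1 _
  by_cases hω : ∏ i, J (ω i) = 0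
  · simp [hω]
  rw [sum_log_prod_eq hJ.1 hL hω]
  simp only [Real.exp_lt_exp]
  split_ifs with h1 h2
  · exact le_rfl
  · exact absurd (le_abs.mpr (Or.inr (by linarith))) h2
  · exact hP
  · exact le_rfl

/-- Atypically small likelihoods are improbable. -/
lemma sum_prod_ite_small_le (hJ : IsPMF J) (hL : ∀ a, 0 < J a → 0 < L a) {δ : ℝ} (hδ : 0 < δ)
    {n : ℕ} (hn : 0 < n) :
    ∑ ω : Fin n → Ω, (if ∏ i, L (ω i) < Real.exp (-(n * (∑ a, J a * -Real.log (L a) + δ)))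
        then ∏ i, J (ω i) else 0)
      ≤ (∑ a, J a * (-Real.log (L a) - ∑ a, J a * -Real.log (L a)) ^ 2) / (n * δ ^ 2) := by
  refine (Finset.sum_le_sum fun ω _ => ?_).trans
    (sum_prod_ite_le hJ (fun a => -Real.log (L a)) hδ hn)
  have hP : 0 ≤ ∏ i, J (ω i) := Finset.prod_nonneg fun i _ => hJ.1 _
  by_cases hω : ∏ i, J (ω i) = 0
  · simp [hω]
  rw [sum_log_prod_eq hJ.1 hL hω]
  simp only [Real.exp_lt_exp]
  split_ifs with h1 h2
  · exact le_rfl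
  · exact absurd (le_abs.mpr (Or.inl (by linarith))) h2
  · exact hP
  · exact le_rfl

end ProductSource

section BlockCode

variable {X Y Z U : Type*} [Fintype X] [Fintype Y] [Fintype Z] [Fintype U]

lemma two_rpow_le_msgCard (n : ℕ) (R : ℝ) : (2 : ℝ) ^ (n * R) ≤ msgCard n R := Nat.le_ceil _

lemma msgCard_pos (n : ℕ) (R : ℝ) : 0 < msgCard n R :=
  Nat.ceil_pos.mpr (Real.rpow_pos_of_pos two_pos _)

/-- Block codes of rate `R` whose induced law approaches `p(x, y) Q(z | x, y) κ(m | y, z)`. -/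
lemma exists_block_codes [Nonempty U]
    {p : X × Y → ℝ} {A : X → U → ℝ} {B : U → Y → Z → ℝ}
    {Q : X → Y → Z → ℝ} {C : Y → Z → U → ℝ} {D : Y → U → ℝ} (hp : IsPMF p)
    (hA : ∀ x, IsPMF (A x)) (hB : ∀ u y, IsPMF (B u y)) (hQ : ∀ x y, IsPMF (Q x y))
    (hC : ∀ y z, IsPMF (C y z)) (hD : ∀ y, IsPMF (D y))
    (h : ∀ x y z u, p (x, y) * A x u * B u y z = p (x, y) * Q x y z * C y z u)
    (hDpos : ∀ x y u, 0 < p (x, y) * A x u → 0 < D y u) {R : ℝ}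
    (hR : ∑ t : X × Y × U, p (t.1, t.2.1) * A t.1 t.2.2 * -Real.log (D t.2.1 t.2.2)
      < ∑ t : X × Y × Z × U, p (t.1, t.2.1) * Q t.1 t.2.1 t.2.2.1 * C t.2.1 t.2.2.1 t.2.2.2
          * -Real.log (C t.2.1 t.2.2.1 t.2.2.2) + R * Real.log 2) :
    ∃ b : ℕ → ℝ, Filter.Tendsto b Filter.atTop (nhds 0) ∧ ∀ n, 0 < n →
      ∃ (enc : (Fin n → X) → Fin (msgCard n R) → ℝ)
        (dec : Fin (msgCard n R) → (Fin n → Y) → (Fin n → Z) → ℝ)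
        (κ : (Fin n → Y) → (Fin n → Z) → Fin (msgCard n R) → ℝ),
        (∀ x, IsPMF (enc x)) ∧ (∀ m y, IsPMF (dec m y)) ∧ (∀ y z, IsPMF (κ y z)) ∧
        ∑ x : Fin n → X, ∑ y : Fin n → Y, ∑ z : Fin n → Z, ∑ m,
          |(∏ i, p (x i, y i)) * enc x m * dec m y z
            - (∏ i, p (x i, y i)) * (∏ i, Q (x i) (y i) (z i)) * κ y z m| ≤ b n := by
  set J1 : X × Y × Z × U → ℝ := fun t =>
    p (t.1, t.2.1) * Q t.1 t.2.1 t.2.2.1 * C t.2.1 t.2.2.1 t.2.2.2 with hJ1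
  set L1 : X × Y × Z × U → ℝ := fun t => C t.2.1 t.2.2.1 t.2.2.2 with hL1
  set J2 : X × Y × U → ℝ := fun t => p (t.1, t.2.1) * A t.1 t.2.2 with hJ2
  set L2 : X × Y × U → ℝ := fun t => D t.2.1 t.2.2 with hL2
  have hp1 : ∑ x, ∑ y, p (x, y) = 1 := by rw [← Fintype.sum_prod_type, hp.2]
  have hJ1pmf : IsPMF J1 := by
    refine ⟨fun t => mul_nonneg (mul_nonneg (hp.1 _) ((hQ _ _).1 _)) ((hC _ _).1 _), ?_⟩
    simp only [hJ1, Fintype.sum_prod_type, ← Finset.mul_sum, (hC _ _).2, (hQ _ _).2, mul_one, hp1]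
  have hJ2pmf : IsPMF J2 := by
    refine ⟨fun t => mul_nonneg (hp.1 _) ((hA _).1 _), ?_⟩
    simp only [hJ2, Fintype.sum_prod_type, ← Finset.mul_sum, (hA _).2, mul_one, hp1]
  have hL1pos : ∀ t, 0 < J1 t → 0 < L1 t := fun t ht =>
    pos_of_mul_pos_right ht (mul_nonneg (hp.1 _) ((hQ _ _).1 _))
  have hL2pos : ∀ t, 0 < J2 t → 0 < L2 t := fun t ht => hDpos _ _ _ ht
  set Hc : ℝ := ∑ t, J1 t * -Real.log (L1 t) with hHc
  set Hd : ℝ := ∑ t, J2 t * -Real.log (L2 t) with hHd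
  set Vc : ℝ := ∑ t, J1 t * (-Real.log (L1 t) - Hc) ^ 2 with hVc
  set Vd : ℝ := ∑ t, J2 t * (-Real.log (L2 t) - Hd) ^ 2 with hVd
  have hRlt : Hd < Hc + R * Real.log 2 := hR
  obtain ⟨δ, hδ, hδR⟩ : ∃ δ : ℝ, 0 < δ ∧ 4 * δ = Hc + R * Real.log 2 - Hd :=
    ⟨(Hc + R * Real.log 2 - Hd) / 4, by linarith, by ring⟩
  refine ⟨fun n => 2 * (Real.exp (-(δ / 2) * n) + 2 * (Vc / (n * δ ^ 2)))
    + 2 * (Vd / (n * δ ^ 2) + Real.exp (-δ * n)), ?_, fun n hn => ?_⟩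
  · have hexp : ∀ c : ℝ, 0 < c →
        Filter.Tendsto (fun n : ℕ => Real.exp (-c * n)) Filter.atTop (nhds 0) := fun c hc =>
      Real.tendsto_exp_atBot.comp
        (tendsto_natCast_atTop_atTop.const_mul_atTop_of_neg (neg_lt_zero.mpr hc))
    have hinv : ∀ V : ℝ,
        Filter.Tendsto (fun n : ℕ => V / (n * δ ^ 2)) Filter.atTop (nhds 0) := fun V =>
      tendsto_const_nhds.div_atTop (tendsto_natCast_atTop_atTop.atTop_mul_const (by positivity))
    simpa using (((hexp (δ / 2) (by positivity)).add ((hinv Vc).const_mul 2)).const_mul 2).add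
      (((hinv Vd).add (hexp δ hδ)).const_mul 2)
  · have hn' : (0 : ℝ) < n := by exact_mod_cast hn
    set N : ℕ := ⌈Real.exp (n * (Hc - 2 * δ))⌉₊ with hNdef
    have hNpos : 0 < N := Nat.ceil_pos.mpr (Real.exp_pos _)
    have hNle : Real.exp (n * (Hc - 2 * δ)) ≤ N := Nat.le_ceil _
    have hNlt : (N : ℝ) < Real.exp (n * (Hc - 2 * δ)) + 1 :=
      Nat.ceil_lt_add_one (Real.exp_pos _).le
    have : Nonempty (Fin N) := ⟨⟨0, hNpos⟩⟩
    have : Nonempty (Fin (msgCard n R)) := ⟨⟨0, msgCard_pos n R⟩⟩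
    have hpn := isPMF_prod (n := n) fun _ => hp
    obtain ⟨enc, dec, κ, h1, h2, h3, h4⟩ := exists_code_sum_abs_le
      (F := Fin N) (M := Fin (msgCard n R))
      (p := fun (x : Fin n → X) (y : Fin n → Y) => ∏ i, p (x i, y i))
      (A := fun (x : Fin n → X) (u : Fin n → U) => ∏ i, A (x i) (u i))
      (B := fun (u : Fin n → U) (y : Fin n → Y) (z : Fin n → Z) => ∏ i, B (u i) (y i) (z i))
      (Q := fun (x : Fin n → X) (y : Fin n → Y) (z : Fin n → Z) => ∏ i, Q (x i) (y i) (z i))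
      (C := fun (y : Fin n → Y) (z : Fin n → Z) (u : Fin n → U) => ∏ i, C (y i) (z i) (u i))
      (D := fun (y : Fin n → Y) (u : Fin n → U) => ∏ i, D (y i) (u i))
      (fun x y => Finset.prod_nonneg fun i _ => hp.1 _)
      ((sum_arrow_prod _).trans hpn.2)
      (fun x => isPMF_prod fun i => hA _) (fun u y => isPMF_prod fun i => hB _ _)
      (fun x y => isPMF_prod fun i => hQ _ _) (fun y z => isPMF_prod fun i => hC _ _)
      (fun y => isPMF_prod fun i => hD _)
      (fun x y z u => by
        simp only [← Finset.prod_mul_distrib]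
        exact Finset.prod_congr rfl fun i _ => h _ _ _ _)
      (Real.exp_pos (-(n * (Hc - δ)))).le (Real.exp_pos (-(n * (Hd + δ))))
      (Real.exp_pos (-(δ / 2) * n))
    refine ⟨enc, dec, κ, h1, h2, h3, h4.trans ?_⟩
    have hlarge := sum_prod_ite_large_le hJ1pmf hL1pos hδ hn
    have hsmall := sum_prod_ite_small_le hJ2pmf hL2pos hδ hn
    have e1 : ∑ x : Fin n → X, ∑ y : Fin n → Y, ∑ z : Fin n → Z, ∑ u : Fin n → U,
        (if Real.exp (-(n * (Hc - δ))) < ∏ i, C (y i) (z i) (u i) then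
          (∏ i, p (x i, y i)) * (∏ i, Q (x i) (y i) (z i)) * ∏ i, C (y i) (z i) (u i) else 0)
        ≤ Vc / (n * δ ^ 2) := by
      refine le_trans (le_of_eq ?_) hlarge
      simp only [sum_arrow_prod, ← Finset.prod_mul_distrib]
      rfl
    have e2 : ∑ x : Fin n → X, ∑ y : Fin n → Y, ∑ u : Fin n → U,
        (if ∏ i, D (y i) (u i) < Real.exp (-(n * (Hd + δ))) then
          (∏ i, p (x i, y i)) * ∏ i, A (x i) (u i) else 0) ≤ Vd / (n * δ ^ 2) := by
      refine le_trans (le_of_eq ?_) hsmall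
      simp only [sum_arrow_prod, ← Finset.prod_mul_distrib]
      rfl
    have e3 : Real.exp (-(δ / 2) * n) / 2
        + ((Fintype.card (Fin N) : ℝ) - 1) * Real.exp (-(n * (Hc - δ)))
          / (2 * Real.exp (-(δ / 2) * n)) ≤ Real.exp (-(δ / 2) * n) := by
      have hm : ((N : ℝ) - 1) * Real.exp (-(n * (Hc - δ)))
          ≤ Real.exp (-(δ / 2) * n) * Real.exp (-(δ / 2) * n) := by
        calc _ ≤ Real.exp (n * (Hc - 2 * δ)) * Real.exp (-(n * (Hc - δ))) :=
              mul_le_mul_of_nonneg_right (by linarith) (Real.exp_pos _).le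
          _ = _ := by rw [← Real.exp_add, ← Real.exp_add]; ring_nf
      rw [Fintype.card_fin]
      have : ((N : ℝ) - 1) * Real.exp (-(n * (Hc - δ))) / (2 * Real.exp (-(δ / 2) * n))
          ≤ Real.exp (-(δ / 2) * n) / 2 := by
        rw [div_le_div_iff₀ (by positivity) two_pos]
        linarith
      linarith
    have hMpos := msgCard_pos n R
    have e4 : 1 / (Real.exp (-(n * (Hd + δ)))
        * ((Fintype.card (Fin N) : ℝ) * Fintype.card (Fin (msgCard n R))))
        ≤ Real.exp (-δ * n) := by
      rw [Fintype.card_fin, Fintype.card_fin, div_le_iff₀ (by positivity)]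
      have hM := two_rpow_le_msgCard n R
      rw [Real.rpow_def_of_pos two_pos] at hM
      have hNM := mul_le_mul hNle hM (Real.exp_pos _).le (Nat.cast_nonneg _)
      have hone : Real.exp (-δ * n) * (Real.exp (-(n * (Hd + δ)))
          * (Real.exp (n * (Hc - 2 * δ)) * Real.exp (Real.log 2 * (n * R)))) = 1 := by
        rw [← Real.exp_add, ← Real.exp_add, ← Real.exp_add, Real.exp_eq_one_iff]
        linear_combination (-(n : ℝ)) * hδR
      rw [← hone]
      exact mul_le_mul_of_nonneg_left (mul_le_mul_of_nonneg_left hNM (Real.exp_pos _).le)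
        (Real.exp_pos _).le
    linarith

end BlockCode

section SecureCode

variable {𝒳 𝒴 𝒵 : Type*} [Fintype 𝒳] [Fintype 𝒴] [Fintype 𝒵]

/-- The single-letter kernels behind a secure auxiliary variable. -/
lemma exists_kernels_of_secureAux [Nonempty 𝒵] {pXY : 𝒳 × 𝒴 → ℝ} {Q : 𝒳 → 𝒴 → 𝒵 → ℝ}
    (hp : IsPMF pXY) (hQ : ∀ x y, IsPMF (Q x y)) {k : ℕ} [Nonempty (Fin k)]
    {pU : 𝒳 × 𝒴 × 𝒵 → Fin k → ℝ} (hU : SecureAux pXY Q pU) :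
    ∃ (A : 𝒳 → Fin k → ℝ) (B : Fin k → 𝒴 → 𝒵 → ℝ) (C : 𝒴 → 𝒵 → Fin k → ℝ)
      (D : 𝒴 → Fin k → ℝ),
      (∀ x, IsPMF (A x)) ∧ (∀ u y, IsPMF (B u y)) ∧ (∀ y z, IsPMF (C y z)) ∧
      (∀ y, IsPMF (D y)) ∧
      (∀ x y z u, pXY (x, y) * A x u * B u y z = pXY (x, y) * Q x y z * C y z u) ∧
      (∀ x y u, 0 < pXY (x, y) * A x u → 0 < D y u) ∧
      cmi (jointU pXY Q pU) (fun w => w.2.2.2) (fun w => w.2.2.1) (fun w => w.1) * Real.log 2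
        = ∑ t : 𝒳 × 𝒴 × Fin k, pXY (t.1, t.2.1) * A t.1 t.2.2 * -Real.log (D t.2.1 t.2.2)
          - ∑ t : 𝒳 × 𝒴 × 𝒵 × Fin k, pXY (t.1, t.2.1) * Q t.1 t.2.1 t.2.2.1
            * C t.2.1 t.2.2.1 t.2.2.2 * -Real.log (C t.2.1 t.2.2.1 t.2.2.2) := by
  obtain ⟨hpU, hUXY, hZUYX, hUYZX⟩ := hU
  set J := jointU pXY Q pU with hJdef
  have hJ : ∀ w, 0 ≤ J w := fun w =>
    mul_nonneg (mul_nonneg (hp.1 _) ((hQ _ _).1 _)) ((hpU _).1 _)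
  have hYZX : ∀ x y z, marg J (fun w => ((w.2.2.1, w.2.2.2), w.2.1)) ((y, z), x)
      = pXY (x, y) * Q x y z := by
    intro x y z
    rw [marg_injective_comp (e := fun t : 𝒳 × 𝒴 × 𝒵 => ((t.2.1, t.2.2), t.1)) J (fun w => w.2)
      (fun a b h => by simp_all [Prod.ext_iff]) (x, y, z), marg_eq_sum_ite]
    simp only [Fintype.sum_prod_type (α₁ := Fin k), hJdef, jointU, Finset.sum_ite_eq',
      Finset.mem_univ, if_true]
    rw [← Finset.mul_sum, (hpU _).2, mul_one, jointXYZ]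
  have hXY : ∀ x y, marg J (fun w => (w.2.1, w.2.2.1)) (x, y) = pXY (x, y) := by
    intro x y
    rw [← sum_marg_pair_right J (fun w => (w.2.1, w.2.2.1)) (fun w => w.2.2.2)]
    have : ∀ z, marg J (fun w => ((w.2.1, w.2.2.1), w.2.2.2)) ((x, y), z)
        = pXY (x, y) * Q x y z := fun z => by
      rw [← hYZX]
      exact marg_injective_comp (e := fun t : (𝒴 × 𝒵) × 𝒳 => ((t.2, t.1.1), t.1.2)) J
        (fun w => ((w.2.2.1, w.2.2.2), w.2.1)) (fun a b h => by simp_all [Prod.ext_iff])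
        ((y, z), x)
    simp only [this, ← Finset.mul_sum, (hQ _ _).2, mul_one]
  obtain ⟨A, hA, -, hAm⟩ := exists_kernel_of_cmi_eq_zero hJ hUXY
  obtain ⟨B, hB, -, hBm⟩ := exists_kernel_of_cmi_eq_zero hJ hZUYX
  obtain ⟨C, hC, hCm', hCm⟩ := exists_kernel_of_cmi_eq_zero hJ hUYZX
  obtain ⟨D, hD, hDm⟩ := exists_kernel_marg hJ (fun w => w.1) (fun w => w.2.2.1)
  have hUX : ∀ x y u, marg J (fun w => (w.2.1, w.2.2.1, w.1)) (x, y, u)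
      = pXY (x, y) * A x u := by
    intro x y u
    rw [← hXY, ← hAm]
    exact marg_injective_comp (e := fun t : Fin k × 𝒳 × 𝒴 => (t.2.1, t.2.2, t.1)) J
      (fun w => (w.1, w.2.1, w.2.2.1)) (fun a b h => by simp_all [Prod.ext_iff]) (u, x, y)
  have hXYZU : ∀ x y z u, marg J (fun w => (w.2.1, w.2.2.1, w.2.2.2, w.1)) (x, y, z, u)
      = pXY (x, y) * Q x y z * C (y, z) u := by
    intro x y z u
    rw [← hYZX, ← hCm]
    exact marg_injective_comp
      (e := fun t : Fin k × (𝒴 × 𝒵) × 𝒳 => (t.2.2, t.2.1.1, t.2.1.2, t.1)) J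
      (fun w => (w.1, (w.2.2.1, w.2.2.2), w.2.1)) (fun a b h => by simp_all [Prod.ext_iff])
      (u, (y, z), x)
  refine ⟨A, fun u y => B (u, y), fun y z => C (y, z), D, hA, fun u y => hB _, fun y z => hC _,
    hD, fun x y z u => ?_, fun x y u h => ?_, ?_⟩
  · rw [← hXYZU, ← hUX]
    have h1 : marg J (fun w => (w.2.1, w.2.2.1, w.1)) (x, y, u)
        = marg J (fun w => ((w.1, w.2.2.1), w.2.1)) ((u, y), x) :=
      marg_injective_comp (e := fun t : (Fin k × 𝒴) × 𝒳 => (t.2, t.1.2, t.1.1)) J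
        (fun w => ((w.1, w.2.2.1), w.2.1)) (fun a b h => by simp_all [Prod.ext_iff]) ((u, y), x)
    rw [h1, ← hBm]
    exact marg_injective_comp
      (e := fun t : 𝒳 × 𝒴 × 𝒵 × Fin k => (t.2.2.1, (t.2.2.2, t.2.1), t.1)) J
      (fun w => (w.2.1, w.2.2.1, w.2.2.2, w.1)) (fun a b h => by simp_all [Prod.ext_iff])
      (x, y, z, u)
  · rw [← hUX] at h
    have h2 := h.trans_le (marg_le_marg_comp hJ (fun w => (w.2.1, w.2.2.1, w.1))
      (fun t => (t.2.2, t.2.1)) (x, y, u))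
    rw [hDm] at h2
    exact pos_of_mul_pos_right h2 (marg_nonneg hJ _ _)
  · have hDsum := hof_sub_hof_mul_log_two hJ (fun w => w.1) (fun w => w.2.2.1) hDm
    have hCsum := hof_sub_hof_mul_log_two hJ (fun w => w.1) (fun w => (w.2.2.1, w.2.2.2)) hCm'
    have h1 := sum_marg_mul J (fun w => (w.2.1, w.2.2.1, w.1))
      (fun t => -Real.log (D t.2.1 t.2.2))
    have h2 := sum_marg_mul J (fun w => (w.2.1, w.2.2.1, w.2.2.2, w.1))
      (fun t => -Real.log (C (t.2.1, t.2.2.1) t.2.2.2))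
    have e1 := hof_injective_comp J (fun w => (w.1, w.2.2.1))
      (e := Prod.swap) Prod.swap_injective
    have e2 := hof_injective_comp J (fun w => (w.2.2.1, w.2.2.2))
      (e := Prod.swap) Prod.swap_injective
    have e3 := hof_injective_comp J (fun w => (w.1, (w.2.2.1, w.2.2.2)))
      (e := fun t : Fin k × 𝒴 × 𝒵 => (t.2.2, t.2.1, t.1))
      (fun a b h => by simp_all [Prod.ext_iff])
    simp only [Prod.swap_prod_mk] at e1 e2
    simp only [hUX, hXYZU] at h1 h2
    rw [cmi, e1, e2, e3, h1, h2, ← hDsum, ← hCsum]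
    ring

lemma isPMF_inducedPMF {pXY : 𝒳 × 𝒴 → ℝ} (hp : IsPMF pXY) {n : ℕ} {R : ℝ}
    {enc : (Fin n → 𝒳) → Fin (msgCard n R) → ℝ}
    {dec : Fin (msgCard n R) → (Fin n → 𝒴) → (Fin n → 𝒵) → ℝ}
    (henc : ∀ x, IsPMF (enc x)) (hdec : ∀ m y, IsPMF (dec m y)) :
    IsPMF (inducedPMF pXY n R enc dec) := by
  refine ⟨fun w => mul_nonneg (mul_nonneg (Finset.prod_nonneg fun i _ => hp.1 _)
    ((henc _).1 _)) ((hdec _ _).1 _), ?_⟩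
  simp only [inducedPMF, Fintype.sum_prod_type, ← Finset.mul_sum, (hdec _ _).2, mul_one,
    (henc _).2]
  exact (sum_arrow_prod _).trans (isPMF_prod fun _ => hp).2

/-- A code whose induced law is close to `p(x, y) Q(z | x, y) κ(m | y, z)` computes the channel
accurately and leaks little. -/
lemma tv_le_and_cmi_le_of_sum_abs_le {pXY : 𝒳 × 𝒴 → ℝ} {Q : 𝒳 → 𝒴 → 𝒵 → ℝ} (hp : IsPMF pXY)
    (hQ : ∀ x y, IsPMF (Q x y)) {n : ℕ} {R b : ℝ}
    {enc : (Fin n → 𝒳) → Fin (msgCard n R) → ℝ}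
    {dec : Fin (msgCard n R) → (Fin n → 𝒴) → (Fin n → 𝒵) → ℝ}
    {κ : (Fin n → 𝒴) → (Fin n → 𝒵) → Fin (msgCard n R) → ℝ}
    (henc : ∀ x, IsPMF (enc x)) (hdec : ∀ m y, IsPMF (dec m y)) (hκ : ∀ y z, IsPMF (κ y z))
    (h : ∑ x : Fin n → 𝒳, ∑ y : Fin n → 𝒴, ∑ z : Fin n → 𝒵, ∑ m,
      |(∏ i, pXY (x i, y i)) * enc x m * dec m y z
        - (∏ i, pXY (x i, y i)) * (∏ i, Q (x i) (y i) (z i)) * κ y z m| ≤ b) :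
    tv (fun w : (Fin n → 𝒳) × (Fin n → 𝒴) × (Fin n → 𝒵) =>
        ∑ m, inducedPMF pXY n R enc dec (w.1, w.2.1, m, w.2.2)) (prodXYZ pXY Q n) ≤ b / 2 ∧
    cmi (inducedPMF pXY n R enc dec)
        (fun w => w.2.2.1) (fun w => (w.2.1, w.2.2.2)) (fun w => w.1) * Real.log 2
      ≤ 4 * (1 + b * Real.log (Fintype.card
          ((Fin n → 𝒳) × (Fin n → 𝒴) × Fin (msgCard n R) × (Fin n → 𝒵)))) := by
  set q : (Fin n → 𝒳) × (Fin n → 𝒴) × Fin (msgCard n R) × (Fin n → 𝒵) → ℝ := fun w =>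
    (∏ i, pXY (w.1 i, w.2.1 i)) * (∏ i, Q (w.1 i) (w.2.1 i) (w.2.2.2 i))
      * κ w.2.1 w.2.2.2 w.2.2.1 with hqdef
  have hqsum : ∀ x y z, ∑ m, q (x, y, m, z)
      = (∏ i, pXY (x i, y i)) * ∏ i, Q (x i) (y i) (z i) := fun x y z => by
    simp only [hqdef, ← Finset.mul_sum, (hκ _ _).2, mul_one]
  have hq : IsPMF q := by
    refine ⟨fun w => mul_nonneg (mul_nonneg (Finset.prod_nonneg fun i _ => hp.1 _)
      (Finset.prod_nonneg fun i _ => (hQ _ _).1 _)) ((hκ _ _).1 _), ?_⟩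
    simp only [Fintype.sum_prod_type]
    have hQn : ∀ (x : Fin n → 𝒳) (y : Fin n → 𝒴),
        ∑ z : Fin n → 𝒵, ∏ i, Q (x i) (y i) (z i) = 1 := fun x y =>
      (isPMF_prod fun i => hQ (x i) (y i)).2
    have : ∀ x y, ∑ m, ∑ z, q (x, y, m, z) = ∏ i, pXY (x i, y i) := fun x y => by
      rw [Finset.sum_comm]
      simp only [hqsum, ← Finset.mul_sum, hQn, mul_one]
    simp only [this]
    exact (sum_arrow_prod _).trans (isPMF_prod fun _ => hp).2
  have hdist : ∑ w, |inducedPMF pXY n R enc dec w - q w| ≤ b := by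
    refine le_trans (le_of_eq ?_) h
    simp only [Fintype.sum_prod_type]
    refine Finset.sum_congr rfl fun x _ => Finset.sum_congr rfl fun y _ => ?_
    rw [Finset.sum_comm]
    rfl
  constructor
  · rw [tv, one_div, inv_mul_eq_div]
    refine div_le_div_of_nonneg_right (le_trans ?_ h) two_pos.le
    simp only [Fintype.sum_prod_type]
    refine Finset.sum_le_sum fun x _ => Finset.sum_le_sum fun y _ =>
      Finset.sum_le_sum fun z _ => ?_
    have hprod : prodXYZ pXY Q n (x, y, z) = ∑ m, q (x, y, m, z) := by
      rw [hqsum, prodXYZ, ← Finset.prod_mul_distrib]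
      rfl
    rw [hprod, ← Finset.sum_sub_distrib]
    exact Finset.abs_sum_le_sum_abs _ _
  · have hz : cmi q (fun w => w.2.2.1) (fun w => (w.2.1, w.2.2.2)) (fun w => w.1) = 0 := by
      refine cmi_eq_zero_of_kernel hq.1 (K := fun t m => κ t.1 t.2 m) fun m ⟨y, z⟩ x => ?_
      have h3 : ∀ m, marg q (fun w => (w.2.2.1, (w.2.1, w.2.2.2), w.1)) (m, (y, z), x)
          = q (x, y, m, z) := fun m => by
        rw [marg_injective_comp (e := fun w : (Fin n → 𝒳) × (Fin n → 𝒴) ×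
          Fin (msgCard n R) × (Fin n → 𝒵) => (w.2.2.1, (w.2.1, w.2.2.2), w.1)) q
          (fun w => w) (fun a b h => by simp_all [Prod.ext_iff]) (x, y, m, z), marg_id]
      rw [← sum_marg_pair_left q (fun w => w.2.2.1) (fun w => ((w.2.1, w.2.2.2), w.1))]
      simp only [h3, hqsum]
      rfl
    have hle := cmi_mul_log_two_le (isPMF_inducedPMF hp henc hdec) hq
      (fun w => w.2.2.1) (fun w => (w.2.1, w.2.2.2)) (fun w => w.1)
    rw [hz, zero_mul, zero_add] at hle
    refine hle.trans ?_
    have hlog := Real.log_natCast_nonneg (Fintype.card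
      ((Fin n → 𝒳) × (Fin n → 𝒴) × Fin (msgCard n R) × (Fin n → 𝒵)))
    have := mul_le_mul_of_nonneg_right hdist hlog
    linarith

lemma log_card_le [Nonempty 𝒳] [Nonempty 𝒴] [Nonempty 𝒵] {R : ℝ} (hR : 0 ≤ R) {n : ℕ}
    (hn : 0 < n) :
    Real.log (Fintype.card ((Fin n → 𝒳) × (Fin n → 𝒴) × Fin (msgCard n R) × (Fin n → 𝒵)))
      ≤ n * (Real.log (Fintype.card 𝒳) + Real.log (Fintype.card 𝒴)
          + Real.log (Fintype.card 𝒵) + (R + 1) * Real.log 2) := by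
  have hl2 : 0 < Real.log 2 := Real.log_pos one_lt_two
  have hn1 : (1 : ℝ) ≤ n := by exact_mod_cast hn
  have hX : (Fintype.card 𝒳 : ℝ) ≠ 0 := by exact_mod_cast Fintype.card_ne_zero
  have hY : (Fintype.card 𝒴 : ℝ) ≠ 0 := by exact_mod_cast Fintype.card_ne_zero
  have hZ : (Fintype.card 𝒵 : ℝ) ≠ 0 := by exact_mod_cast Fintype.card_ne_zero
  have hMpos : (0 : ℝ) < msgCard n R := by exact_mod_cast msgCard_pos n R
  have hM : Real.log (msgCard n R) ≤ n * ((R + 1) * Real.log 2) := by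
    have hrpos : (0 : ℝ) < 2 ^ (n * R) := Real.rpow_pos_of_pos two_pos _
    have h1 : (1 : ℝ) ≤ 2 ^ (n * R) := Real.one_le_rpow one_le_two (by positivity)
    have h2 : (msgCard n R : ℝ) ≤ 2 * 2 ^ (n * R) := by
      have := Nat.ceil_lt_add_one hrpos.le
      rw [msgCard]
      linarith
    have h3 := Real.log_le_log hMpos h2
    rw [Real.log_mul two_ne_zero hrpos.ne', Real.log_rpow two_pos] at h3
    have := mul_le_mul_of_nonneg_right hn1 hl2.le
    linarith
  simp only [Fintype.card_prod, Fintype.card_fun, Fintype.card_fin, Nat.cast_mul, Nat.cast_pow]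
  rw [Real.log_mul (by positivity) (by positivity), Real.log_mul (by positivity) (by positivity),
    Real.log_mul (by positivity) (by positivity), Real.log_pow, Real.log_pow, Real.log_pow]
  linarith

lemma exists_isPMF (α : Type*) [Fintype α] [Nonempty α] : ∃ p : α → ℝ, IsPMF p :=
  ⟨fun a => if a = Classical.arbitrary α then 1 else 0,
    fun a => by dsimp only; split_ifs <;> norm_num, by simp⟩

end SecureCode
variable {𝒳 𝒴 𝒵 : Type*} [Fintype 𝒳] [Fintype 𝒴] [Fintype 𝒵]
variable [Nonempty 𝒳] [Nonempty 𝒴] [Nonempty 𝒵]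

/-- If the joint pmf `p_XYZ · p_{U|XYZ}` satisfies the Markov chains
`U−X−Y`, `Z−(U,Y)−X` and `U−(Y,Z)−X`, then every rate `R > I(Z;U|Y)` is securely
achievable for `(p_XY, p_{Z|XY})`. -/
theorem secure_achievability
    (pXY : 𝒳 × 𝒴 → ℝ) (Q : 𝒳 → 𝒴 → 𝒵 → ℝ)
    (hpXY : IsPMF pXY) (hQ : ∀ x y, IsPMF (Q x y))
    (k : ℕ) (pU : 𝒳 × 𝒴 × 𝒵 → Fin k → ℝ) (hU : SecureAux pXY Q pU)
    (R : ℝ)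
    (hR : cmi (jointU pXY Q pU) (fun w => w.2.2.2) (fun w => w.2.2.1) (fun w => w.1) < R) :
    SecurelyAchievable pXY Q R := by
  obtain ⟨w₀⟩ : Nonempty (𝒳 × 𝒴 × 𝒵) := inferInstance
  have hk : Nonempty (Fin k) := by
    by_contra hne
    rw [not_nonempty_iff] at hne
    simpa using (hU.1 w₀).2
  have hl2 : 0 < Real.log 2 := Real.log_pos one_lt_two
  have hR0 : 0 ≤ R := (cmi_nonneg _ (fun w => mul_nonneg (mul_nonneg (hpXY.1 _)
    ((hQ _ _).1 _)) ((hU.1 _).1 _)) _ _ _).trans hR.le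
  obtain ⟨A, B, C, D, hA, hB, hC, hD, h, hDpos, hI⟩ := exists_kernels_of_secureAux hpXY hQ hU
  have hRI := mul_lt_mul_of_pos_right hR hl2
  rw [hI, sub_lt_iff_lt_add'] at hRI
  obtain ⟨b, hb, hcode⟩ := exists_block_codes hpXY hA hB hQ hC hD h hDpos hRI
  have hcodes : ∀ n, ∃ (enc : (Fin n → 𝒳) → Fin (msgCard n R) → ℝ)
      (dec : Fin (msgCard n R) → (Fin n → 𝒴) → (Fin n → 𝒵) → ℝ),
      (∀ x, IsPMF (enc x)) ∧ (∀ m y, IsPMF (dec m y)) ∧ (0 < n →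
        tv (fun w : (Fin n → 𝒳) × (Fin n → 𝒴) × (Fin n → 𝒵) =>
          ∑ m, inducedPMF pXY n R enc dec (w.1, w.2.1, m, w.2.2)) (prodXYZ pXY Q n) ≤ b n / 2 ∧
        cmi (inducedPMF pXY n R enc dec)
            (fun w => w.2.2.1) (fun w => (w.2.1, w.2.2.2)) (fun w => w.1) * Real.log 2
          ≤ 4 * (1 + b n * Real.log (Fintype.card
            ((Fin n → 𝒳) × (Fin n → 𝒴) × Fin (msgCard n R) × (Fin n → 𝒵))))) := by
    intro n
    rcases Nat.eq_zero_or_pos n with hn | hn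
    · have : Nonempty (Fin (msgCard n R)) := ⟨⟨0, msgCard_pos n R⟩⟩
      obtain ⟨e, he⟩ := exists_isPMF (Fin (msgCard n R))
      obtain ⟨d, hd⟩ := exists_isPMF (Fin n → 𝒵)
      exact ⟨fun _ => e, fun _ _ => d, fun _ => he, fun _ _ => hd, fun h => absurd hn h.ne'⟩
    · obtain ⟨enc, dec, κ, henc, hdec, hκ, hsum⟩ := hcode n hn
      exact ⟨enc, dec, henc, hdec, fun _ =>
        tv_le_and_cmi_le_of_sum_abs_le hpXY hQ henc hdec hκ hsum⟩
  choose enc dec henc hdec hbound using hcodes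
  refine ⟨hR0, enc, dec, henc, hdec, fun ε hε => ?_⟩
  set L : ℝ := Real.log (Fintype.card 𝒳) + Real.log (Fintype.card 𝒴)
    + Real.log (Fintype.card 𝒵) + (R + 1) * Real.log 2 with hL
  have hL0 : 0 ≤ L := by
    have h1 := Real.log_natCast_nonneg (Fintype.card 𝒳)
    have h2 := Real.log_natCast_nonneg (Fintype.card 𝒴)
    have h3 := Real.log_natCast_nonneg (Fintype.card 𝒵)
    positivity
  have hlim : Filter.Tendsto (fun n : ℕ => 4 * (1 / (n : ℝ) + |b n| * L)) Filter.atTop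
      (nhds 0) := by
    simpa using (tendsto_one_div_atTop_nhds_zero_nat.add (hb.abs.mul_const L)).const_mul 4
  obtain ⟨n, hbn, hLn, hn⟩ := ((hb.eventually_le_const hε).and
    ((hlim.eventually_le_const (mul_pos hε hl2)).and (Filter.eventually_gt_atTop 0))).exists
  obtain ⟨htv, hcmi⟩ := hbound n hn
  have hn' : (0 : ℝ) < n := by exact_mod_cast hn
  refine ⟨n, hn, htv.trans (by linarith), le_of_mul_le_mul_right (hcmi.trans ?_) hl2⟩
  have hcard := log_card_le (𝒳 := 𝒳) (𝒴 := 𝒴) (𝒵 := 𝒵) hR0 hn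
  have hlog := Real.log_natCast_nonneg (Fintype.card
    ((Fin n → 𝒳) × (Fin n → 𝒴) × Fin (msgCard n R) × (Fin n → 𝒵)))
  have h1 := mul_le_mul (le_abs_self (b n)) hcard hlog (abs_nonneg _)
  have h2 := mul_le_mul_of_nonneg_left hLn hn'.le
  have h3 : (n : ℝ) * (4 * (1 / (n : ℝ) + |b n| * L)) = 4 * (1 + |b n| * (n * L)) := by
    field_simp
  linarith

end SC
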